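/- Let n ≥ 2 and let μ = f·ν be a finite complex Borel measure on S^{2n−1}. Suppose there exist ε ∈ (0,1) and a finite set F ⊆ ℤ₊² such that for every (p,q) ∈ ℤ₊² ∖ F with (p,q) ∈ κ(ε) one has π_{p,q}μ = 0. Then for every Borel set E ⊆ S^{2n−1} with Hausdorff dimension dim_H E < 2n−2 one has μ(E) = ∫_E f dν = 0 (i.e. the lower Hausdorff dimension of μ is at least 2n−2). -/

import Mathlib

open MeasureTheory Metric Set
open scoped ENNReal NNReal

noncomputable section

instance {n : ℕ} : MeasurableSpace (EuclideanSpace ℂ (Fin n)) := borel _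
instance {n : ℕ} : BorelSpace (EuclideanSpace ℂ (Fin n)) := ⟨rfl⟩

/-- The unit sphere `S^{2n−1} ⊆ ℂⁿ`. -/
def unitSphere (n : ℕ) : Set (EuclideanSpace ℂ (Fin n)) :=
  Metric.sphere 0 1

/-- The real Laplacian (in the `2n` real variables) of `P : ℂⁿ → ℂ` at `z`, computed
with respect to the orthonormal real basis `e_j, i·e_j`. -/
def cplxLaplacian {n : ℕ} (P : EuclideanSpace ℂ (Fin n) → ℂ)
    (z : EuclideanSpace ℂ (Fin n)) : ℂ :=
  ∑ j : Fin n,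
    (fderiv ℝ (fun w => fderiv ℝ P w (EuclideanSpace.single j 1)) z
        (EuclideanSpace.single j 1) +
      fderiv ℝ (fun w => fderiv ℝ P w (Complex.I • EuclideanSpace.single j 1)) z
        (Complex.I • EuclideanSpace.single j 1))

/-- `P : ℂⁿ → ℂ` is (the extension of) an element of `H(p,q)`: smooth, harmonic in the
`2n` real variables, and `(p,q)`-homogeneous: `P(λz) = λᵖ (conj λ)^q P(z)`. -/
def MemHpq (n p q : ℕ) (P : EuclideanSpace ℂ (Fin n) → ℂ) : Prop :=
  ContDiff ℝ (⊤ : ℕ∞) P ∧ (∀ z, cplxLaplacian P z = 0) ∧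
  ∀ (c : ℂ) (z : EuclideanSpace ℂ (Fin n)),
    P (c • z) = c ^ p * (starRingEnd ℂ c) ^ q * P z

/-- `π_{p,q}μ = 0` for the complex measure `μ = f·ν` on the sphere:
`∫ conj(h) dμ = 0` for every `h ∈ H(p,q)`. -/
def projPQZero {n : ℕ} (ν : Measure (EuclideanSpace ℂ (Fin n)))
    (f : EuclideanSpace ℂ (Fin n) → ℂ) (p q : ℕ) : Prop :=
  ∀ P : EuclideanSpace ℂ (Fin n) → ℂ, MemHpq n p q P →
    ∫ z, (starRingEnd ℂ) (P z) * f z ∂ν = 0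

/-- `(p,q) ∈ κ(ε) = {(x,y) ∈ (0,∞)² : 1−ε < y/x < 1/(1−ε)}`. -/
def memKappa (ε : ℝ) (p q : ℕ) : Prop :=
  0 < p ∧ 0 < q ∧ 1 - ε < (q : ℝ) / p ∧ (q : ℝ) / p < 1 / (1 - ε)

/-- The circle orbit `𝕋·E = {e^{it} z : z ∈ E, t ∈ ℝ}`. -/
def circleOrbit {n : ℕ} (E : Set (EuclideanSpace ℂ (Fin n))) :
    Set (EuclideanSpace ℂ (Fin n)) :=
  {w | ∃ z ∈ E, ∃ t : ℝ, w = Complex.exp (t * Complex.I) • z}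

/-! ### Algebra of bihomogeneous polynomials in `z` and `conj z` -/

abbrev Pol (n : ℕ) := MvPolynomial (Fin n ⊕ Fin n) ℂ

def wtl {n : ℕ} : Fin n ⊕ Fin n → ℕ := Sum.elim (fun _ => 1) (fun _ => 0)
def wtr {n : ℕ} : Fin n ⊕ Fin n → ℕ := Sum.elim (fun _ => 0) (fun _ => 1)

/-- Bihomogeneous polynomials of bidegree `(a,b)`. -/
def biHom (n a b : ℕ) : Submodule ℂ (Pol n) :=
  MvPolynomial.weightedHomogeneousSubmodule ℂ wtl a ⊓
    MvPolynomial.weightedHomogeneousSubmodule ℂ wtr b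

/-- `∑ ∂_{z_j} ∂_{conj z_j}`. -/
def lapP {n : ℕ} : Pol n →ₗ[ℂ] Pol n :=
  ∑ j : Fin n, (MvPolynomial.pderiv (R := ℂ) (Sum.inl j : Fin n ⊕ Fin n)).toLinearMap ∘ₗ
    (MvPolynomial.pderiv (R := ℂ) (Sum.inr j : Fin n ⊕ Fin n)).toLinearMap

lemma lapP_apply {n : ℕ} (P : Pol n) : lapP P =
    ∑ j : Fin n, MvPolynomial.pderiv (Sum.inl j) (MvPolynomial.pderiv (Sum.inr j) P) := by
  simp [lapP]

def rhoP (n : ℕ) : Pol n := ∑ j : Fin n, MvPolynomial.X (Sum.inl j) * MvPolynomial.X (Sum.inr j)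

/-- Harmonic bihomogeneous polynomials. -/
def harm (n a b : ℕ) : Submodule ℂ (Pol n) := biHom n a b ⊓ LinearMap.ker lapP

lemma euler_l {n a b : ℕ} {P : Pol n} (h : P ∈ biHom n a b) :
    ∑ j : Fin n, MvPolynomial.X (Sum.inl j) * MvPolynomial.pderiv (Sum.inl j) P = (a : ℂ) • P := by
  have := MvPolynomial.IsWeightedHomogeneous.sum_weight_X_mul_pderiv
    ((MvPolynomial.mem_weightedHomogeneousSubmodule ..).1 h.1)
  simpa [wtl, Fintype.sum_sum_type, MvPolynomial.smul_eq_C_mul] using this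

lemma euler_r {n a b : ℕ} {P : Pol n} (h : P ∈ biHom n a b) :
    ∑ j : Fin n, MvPolynomial.X (Sum.inr j) * MvPolynomial.pderiv (Sum.inr j) P = (b : ℂ) • P := by
  have := MvPolynomial.IsWeightedHomogeneous.sum_weight_X_mul_pderiv
    ((MvPolynomial.mem_weightedHomogeneousSubmodule ..).1 h.2)
  simpa [wtr, Fintype.sum_sum_type, MvPolynomial.smul_eq_C_mul] using this

lemma rhoP_mem (n : ℕ) : rhoP n ∈ biHom n 1 1 := by
  refine ⟨?_, ?_⟩
  · refine Submodule.sum_mem _ fun j _ => ?_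
    exact (MvPolynomial.isWeightedHomogeneous_X ℂ wtl (Sum.inl j)).mul
      (MvPolynomial.isWeightedHomogeneous_X ℂ wtl (Sum.inr j))
  · refine Submodule.sum_mem _ fun j _ => ?_
    exact (MvPolynomial.isWeightedHomogeneous_X ℂ wtr (Sum.inl j)).mul
      (MvPolynomial.isWeightedHomogeneous_X ℂ wtr (Sum.inr j))

lemma biHom_mul {n a b a' b' : ℕ} {P Q : Pol n} (hP : P ∈ biHom n a b) (hQ : Q ∈ biHom n a' b') :
    P * Q ∈ biHom n (a + a') (b + b') :=
  ⟨MvPolynomial.IsWeightedHomogeneous.mul hP.1 hQ.1,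
   MvPolynomial.IsWeightedHomogeneous.mul hP.2 hQ.2⟩

lemma rhoP_mul_mem {n a b : ℕ} {P : Pol n} (hP : P ∈ biHom n a b) :
    rhoP n * P ∈ biHom n (a + 1) (b + 1) := by
  rw [add_comm a, add_comm b]; exact biHom_mul (rhoP_mem n) hP

lemma lapP_mem {n a b : ℕ} {P : Pol n} (hP : P ∈ biHom n (a + 1) (b + 1)) :
    lapP P ∈ biHom n a b := by
  rw [lapP_apply]
  refine ⟨?_, ?_⟩
  · refine Submodule.sum_mem _ fun j _ => ?_
    exact MvPolynomial.IsWeightedHomogeneous.pderiv (n := a + 1)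
      (MvPolynomial.IsWeightedHomogeneous.pderiv hP.1 (by simp [wtl])) (by simp [wtl])
  · refine Submodule.sum_mem _ fun j _ => ?_
    exact MvPolynomial.IsWeightedHomogeneous.pderiv (n := b)
      (MvPolynomial.IsWeightedHomogeneous.pderiv hP.2 (by simp [wtr])) (by simp [wtr])

/-- a polynomial of weight zero has vanishing derivatives in the weighted variables -/
lemma pderiv_eq_zero_of_wt {n : ℕ} {w : Fin n ⊕ Fin n → ℕ} {P : Pol n} {i : Fin n ⊕ Fin n}
    (hi : w i = 1) (hP : MvPolynomial.IsWeightedHomogeneous w P 0) :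
    MvPolynomial.pderiv i P = 0 := by
  apply MvPolynomial.pderiv_eq_zero_of_notMem_vars
  intro hmem
  obtain ⟨d, hd, hdi⟩ := (MvPolynomial.mem_vars_iff_mem_support i).1 hmem
  have h1 := hP (MvPolynomial.mem_support_iff.1 hd)
  have h2 : d i * w i ≤ Finsupp.weight w d := by
    rw [Finsupp.weight_apply, Finsupp.sum]
    exact Finset.single_le_sum (f := fun i => d i • w i) (fun _ _ => Nat.zero_le _) hdi
  rw [h1, hi] at h2
  have := Finsupp.mem_support_iff.1 hdi
  omega

lemma lapP_zero_left {n b : ℕ} {P : Pol n} (hP : P ∈ biHom n 0 b) : lapP P = 0 := by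
  rw [lapP_apply]
  refine Finset.sum_eq_zero fun j _ => ?_
  exact pderiv_eq_zero_of_wt (w := wtl) (by simp [wtl])
      (MvPolynomial.IsWeightedHomogeneous.pderiv hP.1 (by simp [wtl]))

lemma lapP_zero_right {n a : ℕ} {P : Pol n} (hP : P ∈ biHom n a 0) : lapP P = 0 := by
  rw [lapP_apply]
  refine Finset.sum_eq_zero fun j _ => ?_
  rw [pderiv_eq_zero_of_wt (w := wtr) (by simp [wtr]) hP.2, map_zero]

lemma pderiv_rho_l {n : ℕ} (j : Fin n) :
    MvPolynomial.pderiv (Sum.inl j) (rhoP n) = MvPolynomial.X (Sum.inr j) := by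
  classical
  simp [rhoP, Derivation.leibniz, MvPolynomial.pderiv_X, Pi.single_apply]

lemma pderiv_rho_r {n : ℕ} (j : Fin n) :
    MvPolynomial.pderiv (Sum.inr j) (rhoP n) = MvPolynomial.X (Sum.inl j) := by
  classical
  simp [rhoP, Derivation.leibniz, MvPolynomial.pderiv_X, Pi.single_apply]

lemma lapP_rho_mul {n a b : ℕ} {P : Pol n} (hP : P ∈ biHom n a b) :
    lapP (rhoP n * P) = ((n + a + b : ℕ) : ℂ) • P + rhoP n * lapP P := by
  have h1 : ∀ j : Fin n, MvPolynomial.pderiv (Sum.inl j)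
      (MvPolynomial.pderiv (Sum.inr j) (rhoP n * P)) =
      rhoP n * MvPolynomial.pderiv (Sum.inl j) (MvPolynomial.pderiv (Sum.inr j) P)
      + MvPolynomial.X (Sum.inr j) * MvPolynomial.pderiv (Sum.inr j) P
      + MvPolynomial.X (Sum.inl j) * MvPolynomial.pderiv (Sum.inl j) P + P := by
    intro j
    simp [Derivation.leibniz, pderiv_rho_l, pderiv_rho_r]
    ring
  rw [lapP_apply, Finset.sum_congr rfl fun j _ => h1 j, Finset.sum_add_distrib,
    Finset.sum_add_distrib, Finset.sum_add_distrib, euler_l hP, euler_r hP, ← Finset.mul_sum,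
    ← lapP_apply]
  simp [MvPolynomial.smul_eq_C_mul]
  ring

lemma solve_aux {n : ℕ} (hn : 2 ≤ n) : ∀ (a b : ℕ) (c : ℝ), 0 < c → ∀ G ∈ biHom n a b,
    ∃ R ∈ biHom n a b, (c : ℂ) • R + rhoP n * lapP R = G := by
  intro a
  induction a with
  | zero =>
    intro b c hc G hG
    have hc' : (c : ℂ) ≠ 0 := by exact_mod_cast hc.ne'
    refine ⟨(c : ℂ)⁻¹ • G, Submodule.smul_mem _ _ hG, ?_⟩
    simp [lapP_zero_left hG, smul_smul, hc']
  | succ a ih =>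
    intro b c hc G hG
    have hc' : (c : ℂ) ≠ 0 := by exact_mod_cast hc.ne'
    cases b with
    | zero =>
      refine ⟨(c : ℂ)⁻¹ • G, Submodule.smul_mem _ _ hG, ?_⟩
      simp [lapP_zero_right hG, smul_smul, hc']
    | succ b =>
      obtain ⟨T, hT, hTe⟩ := ih b (c + n + a + b) (by positivity) (lapP G) (lapP_mem hG)
      refine ⟨(c : ℂ)⁻¹ • (G - rhoP n * T),
        Submodule.smul_mem _ _ (Submodule.sub_mem _ hG (rhoP_mul_mem hT)), ?_⟩
      rw [map_smul, map_sub, lapP_rho_mul hT, ← hTe, smul_smul, mul_inv_cancel₀ hc', one_smul]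
      have : MvPolynomial.C (c : ℂ)⁻¹ * MvPolynomial.C (c : ℂ) = (1 : Pol n) := by
        rw [← map_mul, inv_mul_cancel₀ hc', map_one]
      simp only [MvPolynomial.smul_eq_C_mul]
      push_cast
      simp only [map_add]
      linear_combination (rhoP n * T) * this

/-- `G = H + ρ R` with `H` harmonic. -/
lemma harm_decomp {n : ℕ} (hn : 2 ≤ n) {a b : ℕ} {G : Pol n} (hG : G ∈ biHom n (a + 1) (b + 1)) :
    ∃ H ∈ harm n (a + 1) (b + 1), ∃ R ∈ biHom n a b, G = H + rhoP n * R := by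
  obtain ⟨R, hR, hRe⟩ := solve_aux hn a b (n + a + b : ℝ) (by positivity) (lapP G) (lapP_mem hG)
  refine ⟨G - rhoP n * R, ⟨Submodule.sub_mem _ hG (rhoP_mul_mem hR), ?_⟩, R, hR, by ring⟩
  refine LinearMap.mem_ker.2 ?_
  rw [map_sub, lapP_rho_mul hR, ← hRe]
  push_cast
  simp


/-! ### Evaluation of polynomials as functions on `ℂⁿ` -/

abbrev Cn (n : ℕ) := EuclideanSpace ℂ (Fin n)

def pt {n : ℕ} (z : Cn n) : Fin n ⊕ Fin n → ℂ :=
  Sum.elim (fun j => z j) (fun j => (starRingEnd ℂ) (z j))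

def ev {n : ℕ} (P : Pol n) (z : Cn n) : ℂ := MvPolynomial.eval (pt z) P

section evlemmas
variable {n : ℕ}

@[simp] lemma ev_add (P Q : Pol n) (z : Cn n) : ev (P + Q) z = ev P z + ev Q z := by simp [ev]
@[simp] lemma ev_sub (P Q : Pol n) (z : Cn n) : ev (P - Q) z = ev P z - ev Q z := by simp [ev]
@[simp] lemma ev_mul (P Q : Pol n) (z : Cn n) : ev (P * Q) z = ev P z * ev Q z := by simp [ev]
@[simp] lemma ev_smul (c : ℂ) (Q : Pol n) (z : Cn n) : ev (c • Q) z = c * ev Q z := by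
  simp [ev, MvPolynomial.smul_eq_C_mul]
@[simp] lemma ev_zero (z : Cn n) : ev (0 : Pol n) z = 0 := by simp [ev]
@[simp] lemma ev_C (c : ℂ) (z : Cn n) : ev (MvPolynomial.C c : Pol n) z = c := by simp [ev]
@[simp] lemma ev_Xl (j : Fin n) (z : Cn n) : ev (MvPolynomial.X (Sum.inl j) : Pol n) z = z j := by
  simp [ev, pt]
@[simp] lemma ev_Xr (j : Fin n) (z : Cn n) :
    ev (MvPolynomial.X (Sum.inr j) : Pol n) z = (starRingEnd ℂ) (z j) := by
  simp [ev, pt]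
lemma ev_sum {ι : Type*} (s : Finset ι) (f : ι → Pol n) (z : Cn n) :
    ev (∑ i ∈ s, f i) z = ∑ i ∈ s, ev (f i) z := by simp [ev]

def coordL (j : Fin n) : Cn n →L[ℝ] ℂ :=
  (EuclideanSpace.proj j : Cn n →L[ℂ] ℂ).restrictScalars ℝ

@[simp] lemma coordL_apply (j : Fin n) (z : Cn n) : coordL j z = z j := rfl

def coordR (j : Fin n) : Cn n →L[ℝ] ℂ :=
  (Complex.conjCLE : ℂ →L[ℝ] ℂ).comp (coordL j)

@[simp] lemma coordR_apply (j : Fin n) (z : Cn n) : coordR j z = (starRingEnd ℂ) (z j) := rfl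

def dev (P : Pol n) (z : Cn n) : Cn n →L[ℝ] ℂ :=
  ∑ j : Fin n, (ev (MvPolynomial.pderiv (Sum.inl j) P) z • coordL j +
    ev (MvPolynomial.pderiv (Sum.inr j) P) z • coordR j)

lemma dev_apply (P : Pol n) (z v : Cn n) : dev P z v =
    ∑ j : Fin n, (ev (MvPolynomial.pderiv (Sum.inl j) P) z * v j +
    ev (MvPolynomial.pderiv (Sum.inr j) P) z * (starRingEnd ℂ) (v j)) := by
  simp [dev]

lemma ev_X_hasFDerivAt (i : Fin n ⊕ Fin n) (z : Cn n) :
    HasFDerivAt (ev (MvPolynomial.X i : Pol n)) (dev (MvPolynomial.X i) z) z := by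
  classical
  rcases i with i | i
  · have h : ev (MvPolynomial.X (Sum.inl i) : Pol n) = coordL i := by ext; simp
    have h2 : dev (MvPolynomial.X (Sum.inl i) : Pol n) z = coordL i := by
      ext v
      simp [dev_apply, MvPolynomial.pderiv_X, Pi.single_apply, apply_ite (fun P : Pol n => ev P z)]
      simp [ev]
    rw [h, h2]; exact (coordL i).hasFDerivAt
  · have h : ev (MvPolynomial.X (Sum.inr i) : Pol n) = coordR i := by ext; simp
    have h2 : dev (MvPolynomial.X (Sum.inr i) : Pol n) z = coordR i := by
      ext v
      simp [dev_apply, MvPolynomial.pderiv_X, Pi.single_apply, apply_ite (fun P : Pol n => ev P z)]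
      simp [ev]
    rw [h, h2]; exact (coordR i).hasFDerivAt

lemma ev_hasFDerivAt (P : Pol n) : ∀ z, HasFDerivAt (ev P) (dev P z) z := by
  induction P using MvPolynomial.induction_on with
  | C c =>
    intro z
    have h : ev (MvPolynomial.C c : Pol n) = fun _ => c := by ext; simp
    have h2 : dev (MvPolynomial.C c : Pol n) z = 0 := by ext v; simp [dev_apply]
    rw [h, h2]; exact hasFDerivAt_const c z
  | add p q hp hq =>
    intro z
    have h : ev (p + q) = ev p + ev q := by ext; simp
    have h2 : dev (p + q) z = dev p z + dev q z := by
      ext v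
      simp only [dev_apply, map_add, ev_add, add_apply,
        ← Finset.sum_add_distrib]
      exact Finset.sum_congr rfl fun _ _ => by ring
    rw [h, h2]; exact (hp z).add (hq z)
  | mul_X p i hp =>
    intro z
    have h : ev (p * MvPolynomial.X i) = ev p * ev (MvPolynomial.X i) := by ext; simp
    have h2 : dev (p * MvPolynomial.X i) z =
        ev p z • dev (MvPolynomial.X i) z + ev (MvPolynomial.X i) z • dev p z := by
      ext v
      simp only [dev_apply, Derivation.leibniz, smul_eq_mul, ev_add, ev_mul,
        add_apply, smul_apply,
        Finset.mul_sum, ← Finset.sum_add_distrib]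
      exact Finset.sum_congr rfl fun _ _ => by ring
    rw [h, h2]; exact (hp z).mul (ev_X_hasFDerivAt i z)

lemma ev_contDiff (P : Pol n) : ContDiff ℝ (⊤ : ℕ∞) (ev P) := by
  induction P using MvPolynomial.induction_on with
  | C c =>
    have h : ev (MvPolynomial.C c : Pol n) = fun _ => c := by ext; simp
    rw [h]; exact contDiff_const
  | add p q hp hq =>
    have h : ev (p + q) = ev p + ev q := by ext; simp
    rw [h]; exact hp.add hq
  | mul_X p i hp =>
    have h : ev (p * MvPolynomial.X i) = fun z => ev p z * ev (MvPolynomial.X i) z := by ext; simp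
    rw [h]
    refine hp.mul ?_
    rcases i with i | i
    · have h : ev (MvPolynomial.X (Sum.inl i) : Pol n) = coordL i := by ext; simp
      rw [h]; exact (coordL i).contDiff
    · have h : ev (MvPolynomial.X (Sum.inr i) : Pol n) = coordR i := by ext; simp
      rw [h]; exact (coordR i).contDiff

lemma ev_continuous (P : Pol n) : Continuous (ev P) := (ev_contDiff P).continuous

lemma dev_single (P : Pol n) (z : Cn n) (j : Fin n) (c : ℂ) :
    dev P z (c • EuclideanSpace.single j 1) =
    ev (MvPolynomial.pderiv (Sum.inl j) P) z * c +
    ev (MvPolynomial.pderiv (Sum.inr j) P) z * (starRingEnd ℂ) c := by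
  classical
  rw [dev_apply, Finset.sum_eq_single j]
  · simp
  · intro b _ hb
    simp [hb]
  · simp

lemma pderiv_comm' (i j : Fin n ⊕ Fin n) (P : Pol n) :
    MvPolynomial.pderiv i (MvPolynomial.pderiv j P) =
    MvPolynomial.pderiv j (MvPolynomial.pderiv i P) := by
  classical
  have h : ⁅MvPolynomial.pderiv (R := ℂ) i, MvPolynomial.pderiv (R := ℂ) j⁆ = 0 := by
    apply MvPolynomial.derivation_ext
    intro k
    simp [Derivation.commutator_apply, MvPolynomial.pderiv_X, Pi.single_apply,
      apply_ite (fun Q : Pol n => MvPolynomial.pderiv i Q),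
      apply_ite (fun Q : Pol n => MvPolynomial.pderiv j Q)]
  have := congrArg (fun D => D P) h
  simpa [Derivation.commutator_apply, sub_eq_zero] using this

lemma cplxLaplacian_ev (P : Pol n) (z : Cn n) : cplxLaplacian (ev P) z = 4 * ev (lapP P) z := by
  rw [cplxLaplacian, lapP_apply, ev_sum, Finset.mul_sum]
  refine Finset.sum_congr rfl fun j _ => ?_
  have h1 : (fun w => fderiv ℝ (ev P) w (EuclideanSpace.single j 1)) =
      ev (MvPolynomial.pderiv (Sum.inl j) P + MvPolynomial.pderiv (Sum.inr j) P) := by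
    ext w
    have := dev_single P w j 1
    rw [one_smul] at this
    rw [(ev_hasFDerivAt P w).fderiv, this]; simp
  have h2 : (fun w => fderiv ℝ (ev P) w (Complex.I • EuclideanSpace.single j 1)) =
      ev (Complex.I • (MvPolynomial.pderiv (Sum.inl j) P - MvPolynomial.pderiv (Sum.inr j) P)) := by
    ext w
    rw [(ev_hasFDerivAt P w).fderiv, dev_single]; simp; ring
  rw [h1, h2, (ev_hasFDerivAt _ z).fderiv, (ev_hasFDerivAt _ z).fderiv, dev_single]
  have := dev_single (MvPolynomial.pderiv (Sum.inl j) P + MvPolynomial.pderiv (Sum.inr j) P) z j 1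
  rw [one_smul] at this
  rw [this]
  simp [pderiv_comm' (Sum.inr j) (Sum.inl j)]
  linear_combination (ev (MvPolynomial.pderiv (Sum.inl j) (MvPolynomial.pderiv (Sum.inl j) P)) z
    + ev (MvPolynomial.pderiv (Sum.inr j) (MvPolynomial.pderiv (Sum.inr j) P)) z
    - 2 * ev (MvPolynomial.pderiv (Sum.inl j) (MvPolynomial.pderiv (Sum.inr j) P)) z) *
      Complex.I_mul_I

lemma ev_homog {a b : ℕ} {P : Pol n} (hP : P ∈ biHom n a b) (c : ℂ) (z : Cn n) :
    ev P (c • z) = c ^ a * (starRingEnd ℂ c) ^ b * ev P z := by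
  rw [ev, ev, MvPolynomial.eval_eq', MvPolynomial.eval_eq', Finset.mul_sum]
  refine Finset.sum_congr rfl fun d hd => ?_
  have h1 : Finsupp.weight wtl d = a := hP.1 (MvPolynomial.mem_support_iff.1 hd)
  have h2 : Finsupp.weight wtr d = b := hP.2 (MvPolynomial.mem_support_iff.1 hd)
  rw [Finsupp.weight_apply, Finsupp.sum_fintype _ _ (by simp)] at h1 h2
  simp [Fintype.sum_sum_type, wtl, wtr] at h1 h2
  simp only [Fintype.prod_sum_type, pt, Sum.elim_inl, Sum.elim_inr, PiLp.smul_apply, smul_eq_mul,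
    map_mul, mul_pow, Finset.prod_mul_distrib, Finset.prod_pow_eq_pow_sum, h1, h2]
  ring

lemma memHpq_ev {a b : ℕ} {P : Pol n} (hP : P ∈ harm n a b) : MemHpq n a b (ev P) := by
  refine ⟨ev_contDiff P, fun z => ?_, ev_homog hP.1⟩
  have : lapP P = 0 := hP.2
  rw [cplxLaplacian_ev, this]; simp

/-- formal conjugate -/
def conjP : Pol n →+* Pol n :=
  (MvPolynomial.rename (R := ℂ) (Sum.swap : Fin n ⊕ Fin n → _)).toRingHom.comp
    (MvPolynomial.map (starRingEnd ℂ))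

lemma conjP_apply (P : Pol n) :
    conjP P = MvPolynomial.rename Sum.swap (MvPolynomial.map (starRingEnd ℂ) P) := rfl

lemma ev_conjP (P : Pol n) (z : Cn n) : ev (conjP P) z = (starRingEnd ℂ) (ev P z) := by
  induction P using MvPolynomial.induction_on with
  | C c => simp [conjP_apply]
  | add p q hp hq => simp [hp, hq]
  | mul_X p i hp =>
    rw [map_mul, ev_mul, hp, ev_mul, map_mul]
    rcases i with i | i <;> simp [conjP_apply]

lemma pderiv_conjP (i : Fin n ⊕ Fin n) (P : Pol n) :
    MvPolynomial.pderiv (Sum.swap i) (conjP P) = conjP (MvPolynomial.pderiv i P) := by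
  rw [conjP_apply, conjP_apply, MvPolynomial.pderiv_rename Sum.swap_leftInverse.injective,
    MvPolynomial.pderiv_map]

lemma lapP_conjP (P : Pol n) : lapP (conjP P) = conjP (lapP P) := by
  rw [lapP_apply, lapP_apply, map_sum]
  refine Finset.sum_congr rfl fun j _ => ?_
  have h1 := pderiv_conjP (Sum.inl j) P
  have h2 := pderiv_conjP (Sum.inr j) (MvPolynomial.pderiv (Sum.inl j) P)
  simp only [Sum.swap_inl, Sum.swap_inr] at h1 h2
  rw [h1, h2, pderiv_comm']

lemma euler_r_conjP {a b : ℕ} {P : Pol n} (h : P ∈ biHom n a b) :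
    ∑ j : Fin n, MvPolynomial.X (Sum.inr j) * MvPolynomial.pderiv (Sum.inr j) (conjP P) =
      (a : ℂ) • conjP P := by
  have := congrArg conjP (euler_l h)
  rw [map_sum] at this
  rw [MvPolynomial.smul_eq_C_mul, map_mul] at this
  rw [MvPolynomial.smul_eq_C_mul]
  convert this using 1
  · refine Finset.sum_congr rfl fun j _ => ?_
    have h1 := pderiv_conjP (Sum.inl j) P
    simp only [Sum.swap_inl] at h1
    rw [map_mul, h1]
    simp [conjP_apply]
  · simp [conjP_apply]

end evlemmas


/-! ### Integration by parts and orthogonality on the sphere -/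

def gfun (s : ℝ) : ℝ := max 0 (1 - s)
def chi (t : ℝ) : ℝ := ∫ s in (1 : ℝ)..t, gfun s

lemma gfun_cont : Continuous gfun := by unfold gfun; fun_prop
lemma gfun_zero {s : ℝ} (h : 1 ≤ s) : gfun s = 0 := by
  unfold gfun; rw [max_eq_left]; linarith
lemma gfun_nonneg (s : ℝ) : 0 ≤ gfun s := le_max_left _ _

lemma chi_hasDerivAt (t : ℝ) : HasDerivAt chi (gfun t) t :=
  intervalIntegral.integral_hasDerivAt_right (gfun_cont.intervalIntegrable _ _)
    (gfun_cont.stronglyMeasurableAtFilter _ _) gfun_cont.continuousAt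

lemma chi_cont : Continuous chi :=
  continuous_iff_continuousAt.2 fun t => (chi_hasDerivAt t).continuousAt

lemma chi_zero {t : ℝ} (h : 1 ≤ t) : chi t = 0 := by
  unfold chi
  rw [intervalIntegral.integral_congr (g := fun _ => 0)]
  · simp
  · intro s hs
    rw [Set.uIcc_of_le h] at hs
    exact gfun_zero hs.1

section ibp
variable {n : ℕ}

lemma compact_supp {u : ℝ → ℝ} (hu0 : ∀ t, 1 ≤ t → u t = 0) (Φ : Cn n → ℂ) :
    HasCompactSupport (fun z : Cn n => Φ z * (u (‖z‖ ^ 2) : ℂ)) := by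
  refine HasCompactSupport.of_support_subset_isCompact (isCompact_closedBall (0 : Cn n) 1) ?_
  intro z hz
  rw [mem_closedBall_zero_iff]
  by_contra hlt
  push Not at hlt
  apply hz
  simp [hu0 (‖z‖ ^ 2) (by nlinarith)]

lemma weight_integrable {u : ℝ → ℝ} (hu : Continuous u) (hu0 : ∀ t, 1 ≤ t → u t = 0)
    {Φ : Cn n → ℂ} (hΦ : Continuous Φ) :
    Integrable (fun z : Cn n => Φ z * (u (‖z‖ ^ 2) : ℂ)) Measure.addHaar := by
  refine Continuous.integrable_of_hasCompactSupport (by fun_prop) (compact_supp hu0 Φ)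

/-- integration against the weight `u(|z|²)` -/
def wInt (u : ℝ → ℝ) (hu : Continuous u) (hu0 : ∀ t, 1 ≤ t → u t = 0) : Pol n →ₗ[ℂ] ℂ where
  toFun P := ∫ z : Cn n, ev P z * (u (‖z‖ ^ 2) : ℂ) ∂Measure.addHaar
  map_add' P Q := by
    rw [← integral_add (weight_integrable hu hu0 (ev_continuous P))
      (weight_integrable hu hu0 (ev_continuous Q))]
    congr 1; ext z; simp; ring
  map_smul' c P := by
    simp only [ev_smul, RingHom.id_apply, smul_eq_mul]
    rw [← integral_const_mul]
    congr 1; ext z; ring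

def Ichi : Pol n →ₗ[ℂ] ℂ := wInt chi chi_cont fun _ => chi_zero
def Ig : Pol n →ₗ[ℂ] ℂ := wInt gfun gfun_cont fun _ => gfun_zero

lemma ev_rho (z : Cn n) : ev (rhoP n) z = ((‖z‖ ^ 2 : ℝ) : ℂ) := by
  rw [rhoP, ev_sum, EuclideanSpace.norm_sq_eq]
  push_cast
  refine Finset.sum_congr rfl fun j _ => ?_
  simp [Complex.mul_conj']

lemma normsq_hasFDerivAt (z : Cn n) :
    HasFDerivAt (fun z : Cn n => ‖z‖ ^ 2) (Complex.reCLM.comp (dev (rhoP n) z)) z := by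
  have h : (fun z : Cn n => ‖z‖ ^ 2) = fun z => Complex.reCLM (ev (rhoP n) z) := by
    ext z; rw [ev_rho]; exact (Complex.ofReal_re _).symm
  rw [h]
  exact Complex.reCLM.hasFDerivAt.comp z (ev_hasFDerivAt (rhoP n) z)

lemma ibp_v (P : Pol n) (j : Fin n) (c : ℂ) :
    Ichi (c • MvPolynomial.pderiv (Sum.inl j) P +
      (starRingEnd ℂ c) • MvPolynomial.pderiv (Sum.inr j) P) +
    Ig (P * (c • MvPolynomial.X (Sum.inr j) + (starRingEnd ℂ c) • MvPolynomial.X (Sum.inl j))) =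
      0 := by
  set v : Cn n := c • EuclideanSpace.single j 1 with hv
  set Q : Pol n := c • MvPolynomial.pderiv (Sum.inl j) P +
      (starRingEnd ℂ c) • MvPolynomial.pderiv (Sum.inr j) P with hQ
  set R : Pol n := P * (c • MvPolynomial.X (Sum.inr j) +
    (starRingEnd ℂ c) • MvPolynomial.X (Sum.inl j)) with hR
  let Φ : Cn n → ℂ := fun z => ev P z * (chi (‖z‖ ^ 2) : ℂ)
  have hder : ∀ z, HasFDerivAt Φ (ev P z • (Complex.ofRealCLM.comp
      (gfun (‖z‖ ^ 2) • Complex.reCLM.comp (dev (rhoP n) z))) +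
      (chi (‖z‖ ^ 2) : ℂ) • dev P z) z := by
    intro z
    refine (ev_hasFDerivAt P z).mul ?_
    have hc : HasFDerivAt (fun z : Cn n => chi (‖z‖ ^ 2))
        (gfun (‖z‖ ^ 2) • Complex.reCLM.comp (dev (rhoP n) z)) z :=
      HasDerivAt.comp_hasFDerivAt (h₂ := chi) (f := fun z : Cn n => ‖z‖ ^ 2) z
        (chi_hasDerivAt (‖z‖ ^ 2)) (normsq_hasFDerivAt z)
    exact Complex.ofRealCLM.hasFDerivAt.comp z hc
  have hval : ∀ z, fderiv ℝ Φ z v =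
      ev Q z * (chi (‖z‖ ^ 2) : ℂ) + ev R z * (gfun (‖z‖ ^ 2) : ℂ) := by
    intro z
    rw [(hder z).fderiv]
    have h1 : dev (rhoP n) z v = (starRingEnd ℂ) (z j) * c + z j * (starRingEnd ℂ) c := by
      rw [hv, dev_single, pderiv_rho_l, pderiv_rho_r]; simp
    have h2 : ((dev (rhoP n) z v).re : ℂ) = (starRingEnd ℂ) (z j) * c + z j * (starRingEnd ℂ) c := by
      rw [h1]
      apply Complex.ext <;> simp
      ring
    have h3 : dev P z v = ev Q z := by
      rw [hv, dev_single, hQ]; simp; ring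
    simp only [add_apply, smul_apply, ContinuousLinearMap.comp_apply, Complex.reCLM_apply,
      Complex.ofRealCLM_apply, smul_eq_mul, Complex.ofReal_mul, h2, h3]
    simp [hR]; ring
  have hi1 := weight_integrable chi_cont (fun _ => chi_zero) (ev_continuous Q)
  have hi2 := weight_integrable gfun_cont (fun _ => gfun_zero) (ev_continuous R)
  have hi3 := weight_integrable chi_cont (fun _ => chi_zero) (ev_continuous P)
  have key := integral_mul_fderiv_eq_neg_fderiv_mul_of_integrable
    (μ := (Measure.addHaar : Measure (Cn n))) (f := fun _ => (1 : ℂ)) (g := Φ) (v := v)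
    (by simp) (by simp only [hval, one_mul]; exact hi1.add hi2) (by simpa [Φ] using hi3)
    (fun x _ => differentiableAt_const _) (fun x _ => (hder x).differentiableAt)
  simp only [hval, one_mul] at key
  rw [integral_add hi1 hi2] at key
  simp only [fderiv_fun_const, Pi.zero_apply, zero_apply, zero_mul, integral_zero, neg_zero] at key
  exact key

lemma ibp_l (P : Pol n) (j : Fin n) :
    Ichi (MvPolynomial.pderiv (Sum.inl j) P) = - Ig (P * MvPolynomial.X (Sum.inr j)) := by
  have h1 := ibp_v P j 1
  have h2 := ibp_v P j Complex.I
  simp only [mul_add, mul_smul_comm, map_add, map_smul, smul_eq_mul, map_one, one_mul,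
    Complex.conj_I] at h1 h2
  linear_combination (1 / 2) * h1 - (Complex.I / 2) * h2 + (1 / 2) * (
    Ichi (MvPolynomial.pderiv (Sum.inl j) P) - Ichi (MvPolynomial.pderiv (Sum.inr j) P)
    + Ig (P * MvPolynomial.X (Sum.inr j)) - Ig (P * MvPolynomial.X (Sum.inl j))) * Complex.I_mul_I

lemma ibp_r (P : Pol n) (j : Fin n) :
    Ichi (MvPolynomial.pderiv (Sum.inr j) P) = - Ig (P * MvPolynomial.X (Sum.inl j)) := by
  have h1 := ibp_v P j 1
  have h2 := ibp_v P j Complex.I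
  simp only [mul_add, mul_smul_comm, map_add, map_smul, smul_eq_mul, map_one, one_mul,
    Complex.conj_I] at h1 h2
  linear_combination (1 / 2) * h1 + (Complex.I / 2) * h2 - (1 / 2) * (
    Ichi (MvPolynomial.pderiv (Sum.inl j) P) - Ichi (MvPolynomial.pderiv (Sum.inr j) P)
    + Ig (P * MvPolynomial.X (Sum.inr j)) - Ig (P * MvPolynomial.X (Sum.inl j))) * Complex.I_mul_I

lemma orth_aux1 {P T : Pol n} {a' : ℂ} (hT : lapP T = 0)
    (he : ∑ j : Fin n, MvPolynomial.X (Sum.inr j) * MvPolynomial.pderiv (Sum.inr j) T = a' • T) :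
    Ichi (∑ j : Fin n, MvPolynomial.pderiv (Sum.inl j) P * MvPolynomial.pderiv (Sum.inr j) T)
      = - (a' * Ig (P * T)) := by
  rw [lapP_apply] at hT
  have h1 : ∑ j : Fin n, MvPolynomial.pderiv (Sum.inl j) P * MvPolynomial.pderiv (Sum.inr j) T =
      ∑ j : Fin n, MvPolynomial.pderiv (Sum.inl j) (P * MvPolynomial.pderiv (Sum.inr j) T) := by
    have : ∑ j : Fin n, P * MvPolynomial.pderiv (Sum.inl j) (MvPolynomial.pderiv (Sum.inr j) T)
        = 0 := by rw [← Finset.mul_sum, hT, mul_zero]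
    rw [← sub_zero (∑ j : Fin n, MvPolynomial.pderiv (Sum.inl j)
      (P * MvPolynomial.pderiv (Sum.inr j) T)), ← this, ← Finset.sum_sub_distrib]
    refine Finset.sum_congr rfl fun j _ => ?_
    rw [Derivation.leibniz, smul_eq_mul, smul_eq_mul]; ring
  have h2 : ∑ j : Fin n, P * MvPolynomial.pderiv (Sum.inr j) T * MvPolynomial.X (Sum.inr j) =
      a' • (P * T) := by
    rw [← mul_smul_comm, ← he, Finset.mul_sum]
    exact Finset.sum_congr rfl fun j _ => by ring
  rw [h1, map_sum, Finset.sum_congr rfl fun j _ => ibp_l _ j, Finset.sum_neg_distrib, ← map_sum, h2,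
    map_smul, smul_eq_mul]

lemma orth_aux2 {P T : Pol n} {a : ℂ} (hP : lapP P = 0)
    (he : ∑ j : Fin n, MvPolynomial.X (Sum.inl j) * MvPolynomial.pderiv (Sum.inl j) P = a • P) :
    Ichi (∑ j : Fin n, MvPolynomial.pderiv (Sum.inl j) P * MvPolynomial.pderiv (Sum.inr j) T)
      = - (a * Ig (P * T)) := by
  rw [lapP_apply] at hP
  have h1 : ∑ j : Fin n, MvPolynomial.pderiv (Sum.inl j) P * MvPolynomial.pderiv (Sum.inr j) T =
      ∑ j : Fin n, MvPolynomial.pderiv (Sum.inr j) (MvPolynomial.pderiv (Sum.inl j) P * T) := by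
    have : ∑ j : Fin n, MvPolynomial.pderiv (Sum.inl j) (MvPolynomial.pderiv (Sum.inr j) P) * T
        = 0 := by rw [← Finset.sum_mul, hP, zero_mul]
    rw [← sub_zero (∑ j : Fin n, MvPolynomial.pderiv (Sum.inr j)
      (MvPolynomial.pderiv (Sum.inl j) P * T)), ← this, ← Finset.sum_sub_distrib]
    refine Finset.sum_congr rfl fun j _ => ?_
    rw [Derivation.leibniz, smul_eq_mul, smul_eq_mul, pderiv_comm' (Sum.inr j)]; ring
  have h2 : ∑ j : Fin n, MvPolynomial.pderiv (Sum.inl j) P * T * MvPolynomial.X (Sum.inl j) =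
      a • (P * T) := by
    rw [← smul_mul_assoc, ← he, Finset.sum_mul]
    exact Finset.sum_congr rfl fun j _ => by ring
  rw [h1, map_sum, Finset.sum_congr rfl fun j _ => ibp_r _ j, Finset.sum_neg_distrib, ← map_sum, h2,
    map_smul, smul_eq_mul]

lemma Ig_orth {a b a' b' : ℕ} {P Q : Pol n} (hP : P ∈ harm n a b) (hQ : Q ∈ harm n a' b')
    (hne : a ≠ a') : Ig (P * conjP Q) = 0 := by
  have hPl : lapP P = 0 := hP.2
  have hQ0 : lapP Q = 0 := hQ.2
  have hQl : lapP (conjP Q) = 0 := by rw [lapP_conjP, hQ0, map_zero]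
  have e1 := orth_aux1 (P := P) hQl (euler_r_conjP hQ.1)
  have e2 := orth_aux2 (T := conjP Q) hPl (euler_l hP.1)
  rw [e1] at e2
  have h3 : ((a : ℂ) - a') * Ig (P * conjP Q) = 0 := by linear_combination e2
  rcases mul_eq_zero.1 h3 with h | h
  · exact absurd (by exact_mod_cast sub_eq_zero.1 h) hne
  · exact h

abbrev Sph (n : ℕ) := Metric.sphere (0 : Cn n) 1

def sig (n : ℕ) : Measure (Sph n) := (Measure.addHaar : Measure (Cn n)).toSphere

instance : IsFiniteMeasure (sig n) := by unfold sig; infer_instance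
instance : (sig n).IsOpenPosMeasure := by unfold sig; infer_instance

def cmom (n m : ℕ) : ℂ := ∫ r : Ioi (0 : ℝ), ((r : ℝ) : ℂ) ^ m * (gfun ((r : ℝ) ^ 2) : ℂ)
  ∂(Measure.volumeIoiPow (Module.finrank ℝ (Cn n) - 1))

lemma polar [Nontrivial (Cn n)] (m : ℕ) (Φ : Cn n → ℂ)
    (hΦ : ∀ (r : ℝ) (z : Cn n), 0 < r → Φ (r • z) = (r : ℂ) ^ m * Φ z) :
    ∫ z, Φ z * (gfun (‖z‖ ^ 2) : ℂ) ∂Measure.addHaar = (∫ s : Sph n, Φ s ∂sig n) * cmom n m := by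
  let μ : Measure (Cn n) := Measure.addHaar
  have h1 : ∫ z, Φ z * (gfun (‖z‖ ^ 2) : ℂ) ∂μ =
      ∫ x : ({(0)}ᶜ : Set (Cn n)), Φ x * (gfun (‖x.1‖ ^ 2) : ℂ) ∂(μ.comap Subtype.val) := by
    rw [integral_subtype_comap (measurableSet_singleton _).compl
      (fun z => Φ z * (gfun (‖z‖ ^ 2) : ℂ)), restrict_compl_singleton]
  have h2 := (μ.measurePreserving_homeomorphUnitSphereProd).integral_comp
    (Homeomorph.measurableEmbedding _)
    (fun x : Sph n × Ioi (0 : ℝ) => Φ x.1 * (((x.2 : ℝ) : ℂ) ^ m * (gfun ((x.2 : ℝ) ^ 2) : ℂ)))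
  rw [integral_prod_mul (fun s : Sph n => Φ s)
    (fun r : Ioi (0 : ℝ) => (((r : ℝ) : ℂ) ^ m * (gfun ((r : ℝ) ^ 2) : ℂ)))] at h2
  change _ = (∫ s : Sph n, Φ s ∂sig n) * cmom n m at h2
  change ∫ z, Φ z * (gfun (‖z‖ ^ 2) : ℂ) ∂μ = _
  rw [h1, ← h2]
  congr 1
  ext x
  have hx : x.1 ≠ 0 := x.2
  have hx' : 0 < ‖x.1‖ := norm_pos_iff.2 hx
  have h3 : Φ x.1 = (‖x.1‖ : ℂ) ^ m * Φ (‖x.1‖⁻¹ • x.1) := by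
    rw [← hΦ _ _ hx', smul_smul, mul_inv_cancel₀ hx'.ne', one_smul]
  simp only [homeomorphUnitSphereProd_apply_fst_coe, homeomorphUnitSphereProd_apply_snd_coe]
  rw [h3]; ring

lemma cmom_ne_zero [Nontrivial (Cn n)] (m : ℕ) : cmom n m ≠ 0 := by
  have h := polar (n := n) m (fun z => ((‖z‖ : ℝ) : ℂ) ^ m) (by
    intro r z hr
    simp [norm_smul, abs_of_pos hr, mul_pow])
  intro h0
  rw [h0, mul_zero] at h
  have h2 : ∫ z : Cn n, ‖z‖ ^ m * gfun (‖z‖ ^ 2) ∂Measure.addHaar = 0 := by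
    have : ((∫ z : Cn n, ‖z‖ ^ m * gfun (‖z‖ ^ 2) ∂Measure.addHaar : ℝ) : ℂ) = 0 := by
      rw [← integral_complex_ofReal, ← h]; congr 1; ext z; push_cast; rfl
    exact_mod_cast this
  have hg := gfun_cont
  obtain ⟨w, hw⟩ := exists_ne (0 : Cn n)
  have h3 : 0 < ∫ z : Cn n, ‖z‖ ^ m * gfun (‖z‖ ^ 2) ∂Measure.addHaar := by
    refine Continuous.integral_pos_of_hasCompactSupport_nonneg_nonzero
      (x := (2 * ‖w‖)⁻¹ • w) (by fun_prop) ?_ (fun z => by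
        have := gfun_nonneg (‖z‖ ^ 2); positivity) ?_
    · refine HasCompactSupport.of_support_subset_isCompact (isCompact_closedBall (0 : Cn n) 1) ?_
      intro z hz
      rw [mem_closedBall_zero_iff]
      by_contra hlt
      push Not at hlt
      apply hz
      simp [gfun_zero (s := ‖z‖ ^ 2) (by nlinarith)]
    · have hw' : 0 < ‖w‖ := norm_pos_iff.2 hw
      have : ‖(2 * ‖w‖)⁻¹ • w‖ = 1 / 2 := by
        rw [norm_smul, norm_inv, norm_mul, norm_norm]; simp; field_simp
      rw [this]
      unfold gfun
      norm_num
  exact h3.ne' h2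

lemma sph_orth [Nontrivial (Cn n)] {a b a' b' : ℕ} {P Q : Pol n} (hP : P ∈ harm n a b)
    (hQ : Q ∈ harm n a' b') (hne : a ≠ a') :
    ∫ s : Sph n, ev P s * (starRingEnd ℂ) (ev Q s) ∂sig n = 0 := by
  have h := polar (n := n) (a + b + (a' + b')) (ev (P * conjP Q)) (by
    intro r z hr
    have e : (r • z : Cn n) = (r : ℂ) • z := by ext; simp
    rw [e, ev_mul, ev_mul, ev_conjP, ev_conjP, ev_homog hP.1, ev_homog hQ.1]
    simp; ring)
  have h2 := Ig_orth hP hQ hne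
  change ∫ z, ev (P * conjP Q) z * (gfun (‖z‖ ^ 2) : ℂ) ∂Measure.addHaar = 0 at h2
  rw [h2] at h
  have := (mul_eq_zero.1 h.symm).resolve_right (cmom_ne_zero _)
  simpa [ev_conjP] using this

end ibp


/-! ### The `L²` bound for the functional on polynomials of a given type -/

lemma finite_lo (ε : ℝ) (hε0 : 0 < ε) (hε1 : ε < 1) (F : Finset (ℕ × ℕ)) (k : ℤ) :
    {ab : ℕ × ℕ | (ab.1 : ℤ) - ab.2 = k ∧ ¬ (ab ∉ F ∧ memKappa ε ab.1 ab.2)}.Finite := by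
  obtain ⟨N, hN⟩ := exists_nat_gt (|(k : ℝ)| / ε + |(k : ℝ)|)
  refine Set.Finite.subset (F.finite_toSet.union
    ((Set.finite_Iic N).prod (Set.finite_Iic N))) ?_
  rintro ⟨a, b⟩ ⟨hk, hnot⟩
  by_cases hF : (a, b) ∈ F
  · exact Or.inl hF
  right
  have hmem : ¬ memKappa ε a b := fun h => hnot ⟨hF, h⟩
  simp only at hk
  have hk' : (a : ℝ) - b = k := by exact_mod_cast hk
  have h1 := le_abs_self (k : ℝ)
  have h2 := neg_abs_le (k : ℝ)
  have h0 := abs_nonneg (k : ℝ)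
  have hd : 0 ≤ |(k : ℝ)| / ε := by positivity
  by_contra hbig
  apply hmem
  have hab : (N : ℝ) < a ∨ (N : ℝ) < b := by
    by_contra h
    push Not at h
    exact hbig ⟨by simpa using (by exact_mod_cast h.1 : a ≤ N),
      by simpa using (by exact_mod_cast h.2 : b ≤ N)⟩
  have ha : |(k : ℝ)| / ε < a := by rcases hab with h | h <;> linarith
  have hb : |(k : ℝ)| / ε < b := by rcases hab with h | h <;> linarith
  have ha0 : (0 : ℝ) < a := by linarith
  have hb0 : (0 : ℝ) < b := by linarith
  rw [div_lt_iff₀ hε0] at ha hb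
  refine ⟨by exact_mod_cast ha0, by exact_mod_cast hb0, ?_, ?_⟩
  · rw [lt_div_iff₀ ha0]; nlinarith
  · rw [div_lt_div_iff₀ ha0 (by linarith)]; nlinarith

lemma harm_fg (n a b : ℕ) : FiniteDimensional ℂ (harm n a b) := by
  have hfg := MvPolynomial.weightedHomogeneousSubmodule_fg (R := ℂ)
    (fun _ : Fin n ⊕ Fin n => 1) (fun _ => one_ne_zero) (a + b)
  haveI : FiniteDimensional ℂ (MvPolynomial.weightedHomogeneousSubmodule ℂ
    (fun _ : Fin n ⊕ Fin n => 1) (a + b)) := Module.Finite.iff_fg.2 hfg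
  refine Submodule.finiteDimensional_of_le
    (S₂ := MvPolynomial.weightedHomogeneousSubmodule ℂ (fun _ : Fin n ⊕ Fin n => 1) (a + b)) ?_
  intro P hP d hd
  have h1 : Finsupp.weight wtl d = a := hP.1.1 hd
  have h2 : Finsupp.weight wtr d = b := hP.1.2 hd
  rw [Finsupp.weight_apply, Finsupp.sum_fintype _ _ (by simp)] at h1 h2 ⊢
  rw [← h1, ← h2, ← Finset.sum_add_distrib]
  refine Finset.sum_congr rfl fun i _ => ?_
  rcases i with i | i <;> simp [wtl, wtr]

section bound
variable {n : ℕ}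

instance : CompactSpace (Sph n) := isCompact_iff_compactSpace.1 (isCompact_sphere _ _)

def res : Pol n →ₗ[ℂ] C(Sph n, ℂ) where
  toFun P := ⟨fun s => ev P s, (ev_continuous P).comp continuous_subtype_val⟩
  map_add' P Q := by ext s; simp
  map_smul' c P := by ext s; simp

@[simp] lemma res_apply (P : Pol n) (s : Sph n) : res P s = ev P s := rfl

/-- Integration functional against `g·ν`. -/
def Lam (ν : Measure (Sph n)) [IsFiniteMeasure ν] (g : Sph n → ℂ) (hg : Integrable g ν) :
    C(Sph n, ℂ) →L[ℂ] ℂ :=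
  LinearMap.mkContinuous
    { toFun := fun φ => ∫ s, φ s * g s ∂ν
      map_add' := fun φ ψ => by
        rw [← integral_add]
        · congr 1; ext s; simp; ring
        · exact hg.bdd_mul (c := ‖φ‖) (map_continuous φ).aestronglyMeasurable
            (ae_of_all _ fun s => φ.norm_coe_le_norm s)
        · exact hg.bdd_mul (c := ‖ψ‖) (map_continuous ψ).aestronglyMeasurable
            (ae_of_all _ fun s => ψ.norm_coe_le_norm s)
      map_smul' := fun c φ => by
        simp only [ContinuousMap.smul_apply, smul_eq_mul, RingHom.id_apply]
        rw [← integral_const_mul]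
        congr 1; ext s; ring }
    (∫ s, ‖g s‖ ∂ν) (fun φ => by
      refine (norm_integral_le_integral_norm _).trans ?_
      rw [← integral_mul_const]
      refine integral_mono_of_nonneg (ae_of_all _ fun s => norm_nonneg _)
        (hg.norm.mul_const _) (ae_of_all _ fun s => ?_)
      simp only [norm_mul]
      rw [mul_comm]
      exact mul_le_mul_of_nonneg_left (φ.norm_coe_le_norm s) (norm_nonneg _))

lemma Lam_apply (ν : Measure (Sph n)) [IsFiniteMeasure ν] (g : Sph n → ℂ) (hg : Integrable g ν)
    (φ : C(Sph n, ℂ)) : Lam ν g hg φ = ∫ s, φ s * g s ∂ν := rfl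

def toL2 : C(Sph n, ℂ) →L[ℂ] Lp ℂ 2 (sig n) := ContinuousMap.toLp 2 (sig n) ℂ

lemma inner_toL2 (φ ψ : C(Sph n, ℂ)) :
    inner ℂ (toL2 φ) (toL2 ψ) = ∫ s, ψ s * (starRingEnd ℂ) (φ s) ∂sig n :=
  ContinuousMap.inner_toLp (sig n) φ ψ

/-- polynomials of type `k` -/
def typ (n : ℕ) (k : ℤ) : Submodule ℂ (Pol n) :=
  ⨆ ab ∈ {ab : ℕ × ℕ | (ab.1 : ℤ) - ab.2 = k}, biHom n ab.1 ab.2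

lemma decomp_sph (hn : 2 ≤ n) (V : Submodule ℂ (Pol n)) (k : ℤ)
    (hV : ∀ a b : ℕ, (a : ℤ) - b = k → harm n a b ≤ V) :
    ∀ a b : ℕ, (a : ℤ) - b = k → ∀ G ∈ biHom n a b, ∃ v ∈ V, res v = res G := by
  intro a
  induction a with
  | zero =>
    intro b hk G hG
    exact ⟨G, hV 0 b hk ⟨hG, lapP_zero_left hG⟩, rfl⟩
  | succ a ih =>
    intro b hk G hG
    cases b with
    | zero => exact ⟨G, hV _ 0 hk ⟨hG, lapP_zero_right hG⟩, rfl⟩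
    | succ b =>
      obtain ⟨H, hH, R, hR, rfl⟩ := harm_decomp hn hG
      obtain ⟨v, hv, hvR⟩ := ih b (by push_cast at hk; linarith) R hR
      refine ⟨H + v, V.add_mem (hV _ _ hk hH) hv, ?_⟩
      rw [map_add, hvR, map_add]
      congr 1
      ext s
      have : ‖(s : Cn n)‖ = 1 := by simpa using s.2
      simp [ev_rho, this]

lemma fd_bound (V : Submodule ℂ C(Sph n, ℂ)) [FiniteDimensional ℂ V] :
    ∃ K : ℝ, 0 ≤ K ∧ ∀ φ ∈ V, ‖φ‖ ≤ K * ‖toL2 φ‖ := by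
  let T : V →ₗ[ℂ] Lp ℂ 2 (sig n) := (toL2 (n := n)).toLinearMap.comp V.subtype
  have hT : LinearMap.ker T = ⊥ := by
    rw [LinearMap.ker_eq_bot]
    exact (ContinuousMap.toLp_injective (sig n)).comp Subtype.val_injective
  obtain ⟨K, hK0, hK⟩ := LinearMap.exists_antilipschitzWith T hT
  refine ⟨K, K.2, fun φ hφ => ?_⟩
  have h := hK.le_mul_dist (⟨φ, hφ⟩ : V) 0
  rw [map_zero, dist_zero_right, dist_zero_right] at h
  exact h

lemma norm_le_of_orth (x y : Lp ℂ 2 (sig n)) (h : inner ℂ x y = (0 : ℂ)) : ‖x‖ ≤ ‖x + y‖ := by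
  have := norm_add_sq_eq_norm_sq_add_norm_sq_of_inner_eq_zero (𝕜 := ℂ) x y h
  nlinarith [norm_nonneg (x + y), norm_nonneg x, mul_self_nonneg ‖y‖]

lemma key_bound (hn : 2 ≤ n) (ε : ℝ) (hε0 : 0 < ε) (hε1 : ε < 1) (F : Finset (ℕ × ℕ))
    (Λ : C(Sph n, ℂ) →L[ℂ] ℂ)
    (hspec : ∀ p q : ℕ, (p, q) ∉ F → memKappa ε p q → ∀ H ∈ harm n p q, Λ (res H) = 0) (k : ℤ) :
    ∃ C : ℝ, ∀ G ∈ typ n k, ‖Λ (res G)‖ ≤ C * ‖toL2 (res G)‖ := by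
  haveI : Nonempty (Fin n) := ⟨⟨0, by omega⟩⟩
  haveI : Nontrivial (Cn n) := inferInstance
  set I0 := {ab : ℕ × ℕ | (ab.1 : ℤ) - ab.2 = k ∧ ¬ (ab ∉ F ∧ memKappa ε ab.1 ab.2)} with hI0
  set I1 := {ab : ℕ × ℕ | (ab.1 : ℤ) - ab.2 = k ∧ (ab ∉ F ∧ memKappa ε ab.1 ab.2)} with hI1
  have hfin : I0.Finite := finite_lo ε hε0 hε1 F k
  haveI := hfin.to_subtype
  let Lo : Submodule ℂ (Pol n) := ⨆ ab : I0, harm n ab.1.1 ab.1.2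
  let Hi : Submodule ℂ (Pol n) := ⨆ ab : I1, harm n ab.1.1 ab.1.2
  haveI : ∀ ab : I0, FiniteDimensional ℂ (harm n ab.1.1 ab.1.2) := fun ab => harm_fg _ _ _
  haveI : FiniteDimensional ℂ Lo := Submodule.finiteDimensional_iSup _
  let V : Submodule ℂ C(Sph n, ℂ) := Lo.map res
  haveI : FiniteDimensional ℂ V := inferInstance
  obtain ⟨K, hK0, hK'⟩ := fd_bound V
  have horth : ∀ l ∈ Lo, ∀ h ∈ Hi, inner ℂ (toL2 (res l)) (toL2 (res h)) = (0 : ℂ) := by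
    have : (Lo.map ((toL2 (n := n)).toLinearMap.comp res)) ⟂
        (Hi.map ((toL2 (n := n)).toLinearMap.comp res)) := by
      simp only [Lo, Hi, Submodule.map_iSup, Submodule.isOrtho_iSup_left,
        Submodule.isOrtho_iSup_right]
      rintro ⟨⟨a', b'⟩, h1⟩ ⟨⟨a, b⟩, h0⟩
      rw [Submodule.isOrtho_iff_inner_eq]
      rintro _ ⟨P, hP, rfl⟩ _ ⟨Q, hQ, rfl⟩
      change inner ℂ (toL2 (res P)) (toL2 (res Q)) = (0 : ℂ)
      rw [inner_toL2]
      refine sph_orth hQ hP ?_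
      simp only
      intro heq
      apply h0.2
      have e1 := h0.1
      have e2 := h1.1
      simp only at e1 e2
      have : b' = b := by omega
      subst this; subst heq
      exact h1.2
    intro l hl h hh
    exact Submodule.isOrtho_iff_inner_eq.1 this _ ⟨l, hl, rfl⟩ _ ⟨h, hh, rfl⟩
  have hHi : ∀ h ∈ Hi, Λ (res h) = 0 := by
    have : Hi ≤ LinearMap.ker (Λ.toLinearMap.comp res) := by
      refine iSup_le ?_
      rintro ⟨⟨a, b⟩, h1⟩ P hP
      exact LinearMap.mem_ker.2 (hspec a b h1.2.1 h1.2.2 P hP)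
    intro h hh
    exact LinearMap.mem_ker.1 (this hh)
  refine ⟨‖Λ‖ * K, ?_⟩
  intro G hG
  have hdec : ∃ v ∈ Lo ⊔ Hi, res v = res G := by
    have hle : typ n k ≤ ((Lo ⊔ Hi).map res).comap res := by
      refine iSup₂_le ?_
      rintro ⟨a, b⟩ hk G hG
      obtain ⟨v, hv, hvG⟩ := decomp_sph hn (Lo ⊔ Hi) k (by
        intro a b hk
        by_cases hc : (a, b) ∉ F ∧ memKappa ε a b
        · exact le_trans (le_iSup (fun ab : I1 => harm n ab.1.1 ab.1.2) ⟨(a, b), hk, hc⟩)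
            le_sup_right
        · exact le_trans (le_iSup (fun ab : I0 => harm n ab.1.1 ab.1.2) ⟨(a, b), hk, hc⟩)
            le_sup_left) a b hk G hG
      exact ⟨v, hv, hvG⟩
    exact hle hG
  obtain ⟨v, hv, hvG⟩ := hdec
  obtain ⟨l, hl, h, hh, rfl⟩ := Submodule.mem_sup.1 hv
  rw [← hvG, map_add, map_add, hHi h hh, add_zero, map_add]
  have hpy := norm_le_of_orth _ _ (horth l hl h hh)
  calc ‖Λ (res l)‖ ≤ ‖Λ‖ * ‖res l‖ := Λ.le_opNorm _
    _ ≤ ‖Λ‖ * (K * ‖toL2 (res l)‖) := by gcongr; exact hK' _ ⟨l, hl, rfl⟩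
    _ ≤ ‖Λ‖ * (K * ‖toL2 (res l) + toL2 (res h)‖) := by gcongr
    _ = _ := by ring

end bound


/-! ### Cones over small sets are Lebesgue null -/

section cone
variable {n : ℕ}

def cone (t : Set (Cn n)) : Set (Cn n) := {w | ∃ c : ℂ, ‖c‖ ≤ 1 ∧ ∃ y ∈ t, w = c • y}

lemma cone_mono {s t : Set (Cn n)} (h : s ⊆ t) : cone s ⊆ cone t := by
  rintro w ⟨c, hc, y, hy, rfl⟩
  exact ⟨c, hc, y, h hy, rfl⟩

lemma finrank_Cn : Module.finrank ℝ (Cn n) = 2 * n := by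
  rw [← Module.finrank_mul_finrank ℝ ℂ (Cn n), Complex.finrank_real_complex]
  simp

def gridPt (r : ℝ) (ij : ℤ × ℤ) : ℂ := ⟨r * ij.1, r * ij.2⟩

lemma grid_exists {r : ℝ} (hr : 0 < r) {c : ℂ} (hc : ‖c‖ ≤ 1) :
    ∃ ij ∈ Finset.Icc (-(⌈1 / r⌉₊ : ℤ)) ⌈1 / r⌉₊ ×ˢ Finset.Icc (-(⌈1 / r⌉₊ : ℤ)) ⌈1 / r⌉₊,
      ‖c - gridPt r ij‖ ≤ 2 * r := by
  have key : ∀ x : ℝ, |x| ≤ 1 → ⌊x / r⌋ ∈ Finset.Icc (-(⌈1 / r⌉₊ : ℤ)) ⌈1 / r⌉₊ ∧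
      |x - r * ⌊x / r⌋| ≤ r := by
    intro x hx
    have h1 : (1 / r : ℝ) ≤ ⌈1 / r⌉₊ := Nat.le_ceil _
    have h2 := Int.floor_le (x / r)
    have h3 := Int.lt_floor_add_one (x / r)
    rw [abs_le] at hx
    refine ⟨?_, ?_⟩
    · rw [Finset.mem_Icc]
      constructor
      · rw [Int.le_floor]
        push_cast
        have : -(1 / r) ≤ x / r := by rw [← neg_div]; gcongr; exact hx.1
        linarith
      · have : x / r ≤ 1 / r := by gcongr; exact hx.2
        have : ((⌊x / r⌋ : ℤ) : ℝ) ≤ ((⌈1 / r⌉₊ : ℤ) : ℝ) := by push_cast; linarith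
        exact_mod_cast this
    · have e : x = r * (x / r) := by field_simp
      rw [abs_le]
      constructor <;> nlinarith
  obtain ⟨h1, h1'⟩ := key c.re ((Complex.abs_re_le_norm c).trans hc)
  obtain ⟨h2, h2'⟩ := key c.im ((Complex.abs_im_le_norm c).trans hc)
  refine ⟨(⌊c.re / r⌋, ⌊c.im / r⌋), Finset.mem_product.2 ⟨h1, h2⟩, ?_⟩
  refine (Complex.norm_le_abs_re_add_abs_im _).trans ?_
  simp only [gridPt, Complex.sub_re, Complex.sub_im]
  linarith

lemma cone_small (t : Set (Cn n)) (ht1 : ∀ y ∈ t, ‖y‖ = 1) {r : ℝ} (hr : 0 < r)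
    (hr1 : r ≤ 1) (hd : ∀ x ∈ t, ∀ y ∈ t, dist x y ≤ r) (hn : 1 ≤ n) :
    (Measure.addHaar : Measure (Cn n)) (cone t) ≤
      ENNReal.ofReal (25 * 3 ^ (2 * n)) * (Measure.addHaar : Measure (Cn n)) (ball 0 1) *
        ENNReal.ofReal (r ^ (2 * n - 2)) := by
  rcases t.eq_empty_or_nonempty with rfl | ⟨z, hz⟩
  · have : cone (∅ : Set (Cn n)) = ∅ := by ext; simp [cone]
    simp [this]
  set N := ⌈1 / r⌉₊
  set J := Finset.Icc (-(N : ℤ)) N ×ˢ Finset.Icc (-(N : ℤ)) N with hJ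
  have hsub : cone t ⊆ ⋃ ij ∈ J, closedBall (gridPt r ij • z) (3 * r) := by
    rintro w ⟨c, hc, y, hy, rfl⟩
    obtain ⟨ij, hij, h⟩ := grid_exists hr hc
    refine Set.mem_iUnion₂.2 ⟨ij, hij, ?_⟩
    rw [mem_closedBall, dist_eq_norm]
    have e : c • y - gridPt r ij • z = c • (y - z) + (c - gridPt r ij) • z := by
      rw [smul_sub, sub_smul]; abel
    rw [e]
    refine (norm_add_le _ _).trans ?_
    rw [norm_smul, norm_smul, ht1 z hz]
    have := hd y hy z hz
    rw [dist_eq_norm] at this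
    nlinarith [norm_nonneg (y - z), norm_nonneg c]
  have hcard : (J.card : ℝ) ≤ 25 / r ^ 2 := by
    rw [hJ, Finset.card_product, Int.card_Icc]
    have : ((N : ℤ) + 1 - -(N : ℤ)).toNat = 2 * N + 1 := by omega
    rw [this]
    have h1 : (N : ℝ) < 1 / r + 1 := Nat.ceil_lt_add_one (by positivity)
    have h2 : 1 ≤ 1 / r := by rw [le_div_iff₀ hr]; linarith
    have h3 : (2 * N + 1 : ℝ) ≤ 5 / r := by
      have : 5 / r = 5 * (1 / r) := by ring
      rw [this]; linarith
    push_cast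
    have : 25 / r ^ 2 = (5 / r) * (5 / r) := by field_simp; norm_num
    rw [this]
    gcongr
  calc (Measure.addHaar : Measure (Cn n)) (cone t)
      ≤ ∑ ij ∈ J, (Measure.addHaar : Measure (Cn n)) (closedBall (gridPt r ij • z) (3 * r)) :=
        (measure_mono hsub).trans (measure_biUnion_finset_le _ _)
    _ = ENNReal.ofReal J.card * (ENNReal.ofReal ((3 * r) ^ (2 * n)) *
          (Measure.addHaar : Measure (Cn n)) (ball 0 1)) := by
        simp_rw [Measure.addHaar_closedBall _ _ (by positivity : 0 ≤ 3 * r), finrank_Cn]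
        rw [Finset.sum_const, nsmul_eq_mul, ENNReal.ofReal_natCast]
    _ ≤ ENNReal.ofReal (25 / r ^ 2) * (ENNReal.ofReal ((3 * r) ^ (2 * n)) *
          (Measure.addHaar : Measure (Cn n)) (ball 0 1)) := by
        gcongr
    _ = _ := by
        rw [← mul_assoc, ← ENNReal.ofReal_mul (by positivity), mul_right_comm,
          ← ENNReal.ofReal_mul (by positivity)]
        congr 2
        obtain ⟨m, rfl⟩ : ∃ m, n = m + 1 := ⟨n - 1, by omega⟩
        have : 2 * (m + 1) - 2 = 2 * m := by omega
        rw [this]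
        field_simp
        ring

lemma cone_diam (t : Set (Cn n)) (ht1 : ∀ y ∈ t, ‖y‖ = 1) (hd : Metric.ediam t ≤ 1 / 2)
    (hn : 1 ≤ n) :
    (Measure.addHaar : Measure (Cn n)) (cone t) ≤
      ENNReal.ofReal (25 * 3 ^ (2 * n)) * (Measure.addHaar : Measure (Cn n)) (ball 0 1) *
        (Metric.ediam t) ^ (2 * n - 2) := by
  set M := ENNReal.ofReal (25 * 3 ^ (2 * n)) * (Measure.addHaar : Measure (Cn n)) (ball 0 1)
    with hM
  have hMt : M ≠ ⊤ := ENNReal.mul_ne_top ENNReal.ofReal_ne_top measure_ball_lt_top.ne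
  have hfin : Metric.ediam t ≠ ⊤ := ne_top_of_le_ne_top (by norm_num) hd
  set d := (Metric.ediam t).toReal with hdd
  have hd0 : 0 ≤ d := ENNReal.toReal_nonneg
  have hd1 : d < 1 := by
    have : d ≤ (1 / 2 : ℝ≥0∞).toReal := ENNReal.toReal_mono (by norm_num) hd
    have h2 : (1 / 2 : ℝ≥0∞).toReal = 1 / 2 := by norm_num
    rw [h2] at this
    linarith
  have hed : Metric.ediam t = ENNReal.ofReal d := (ENNReal.ofReal_toReal hfin).symm
  have hlim : Filter.Tendsto (fun r : ℝ => M * ENNReal.ofReal (r ^ (2 * n - 2)))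
      (nhdsWithin d (Set.Ioi d)) (nhds (M * ENNReal.ofReal (d ^ (2 * n - 2)))) := by
    refine ENNReal.Tendsto.const_mul ?_ (Or.inr hMt)
    refine (ENNReal.continuous_ofReal.tendsto _).comp ?_
    exact ((continuous_pow _).tendsto d).mono_left nhdsWithin_le_nhds
  rw [hed, ← ENNReal.ofReal_pow hd0]
  refine ge_of_tendsto hlim ?_
  filter_upwards [Ioo_mem_nhdsGT hd1] with r hr
  refine cone_small t ht1 (lt_of_le_of_lt hd0 hr.1) hr.2.le ?_ hn
  intro x hx y hy
  have h := Metric.edist_le_ediam_of_mem hx hy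
  rw [hed, edist_dist] at h
  have := (ENNReal.ofReal_le_ofReal_iff hd0).1 h
  linarith [hr.1]

lemma cone_null (hn : 2 ≤ n) (A : Set (Cn n)) (hA1 : ∀ y ∈ A, ‖y‖ = 1)
    (hA : dimH A < (2 * n - 2 : ℕ)) : (Measure.addHaar : Measure (Cn n)) (cone A) = 0 := by
  have h0 : Measure.hausdorffMeasure (((2 * n - 2 : ℕ) : ℝ)) A = 0 := by
    have := hausdorffMeasure_of_dimH_lt (s := A) (d := ((2 * n - 2 : ℕ) : ℝ≥0))
      (by exact_mod_cast hA)
    exact_mod_cast this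
  rw [Measure.hausdorffMeasure_apply] at h0
  have h1 := (iSup₂_eq_bot.1 h0) (1 / 2) (by norm_num)
  set M := ENNReal.ofReal (25 * 3 ^ (2 * n)) * (Measure.addHaar : Measure (Cn n)) (ball 0 1)
    with hM
  have hMt : M ≠ ⊤ := ENNReal.mul_ne_top ENNReal.ofReal_ne_top measure_ball_lt_top.ne
  have hle : ∀ δ : ℝ≥0∞, 0 < δ → (Measure.addHaar : Measure (Cn n)) (cone A) ≤ M * δ := by
    intro δ hδ
    rw [← bot_eq_zero, ← h1] at hδ
    simp only [iInf_lt_iff] at hδ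
    obtain ⟨t, hcov, hdiam, hsum⟩ := hδ
    have hsub : cone A ⊆ ⋃ i, cone (A ∩ t i) := by
      rintro w ⟨c, hc, y, hy, rfl⟩
      obtain ⟨i, hi⟩ := Set.mem_iUnion.1 (hcov hy)
      exact Set.mem_iUnion.2 ⟨i, c, hc, y, ⟨hy, hi⟩, rfl⟩
    calc (Measure.addHaar : Measure (Cn n)) (cone A)
        ≤ ∑' i, (Measure.addHaar : Measure (Cn n)) (cone (A ∩ t i)) :=
          (measure_mono hsub).trans (measure_iUnion_le _)
      _ ≤ ∑' i, M * ⨆ (_ : (t i).Nonempty), Metric.ediam (t i) ^ (((2 * n - 2 : ℕ) : ℝ)) := by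
          refine ENNReal.tsum_le_tsum fun i => ?_
          refine (cone_diam _ (fun y hy => hA1 y hy.1)
            ((Metric.ediam_mono Set.inter_subset_right).trans (hdiam i)) (by omega)).trans ?_
          rcases (t i).eq_empty_or_nonempty with he | hne
          · rw [he]
            have : 2 * n - 2 ≠ 0 := by omega
            simp [this]
          · simp only [hne, iSup_pos, ENNReal.rpow_natCast]
            gcongr
            exact Set.inter_subset_right
      _ = M * ∑' i, ⨆ (_ : (t i).Nonempty), Metric.ediam (t i) ^ (((2 * n - 2 : ℕ) : ℝ)) :=
          ENNReal.tsum_mul_left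
      _ ≤ M * δ := by gcongr
  have hlim : Filter.Tendsto (fun δ : ℝ≥0∞ => M * δ) (nhdsWithin 0 (Set.Ioi 0)) (nhds (M * 0)) :=
    (ENNReal.Tendsto.const_mul Filter.tendsto_id (Or.inr hMt)).mono_left nhdsWithin_le_nhds
  rw [mul_zero] at hlim
  haveI : (nhdsWithin (0 : ℝ≥0∞) (Set.Ioi 0)).NeBot := inferInstance
  refine le_antisymm (ge_of_tendsto hlim ?_) bot_le
  filter_upwards [self_mem_nhdsWithin] with δ hδ using hle δ hδ

lemma sig_null {A : Set (Cn n)} (hA : (Measure.addHaar : Measure (Cn n)) (cone A) = 0)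
    (B : Set (Sph n)) (hB : MeasurableSet B)
    (hBA : ∀ s ∈ B, ∃ c : ℂ, ‖c‖ = 1 ∧ ∃ y ∈ A, (s : Cn n) = c • y) : sig n B = 0 := by
  rw [sig, Measure.toSphere_apply' _ hB]
  refine mul_eq_zero.2 (Or.inr (measure_mono_null ?_ hA))
  rintro w ⟨r, hr, _, ⟨s, hs, rfl⟩, rfl⟩
  obtain ⟨c, hc, y, hy, e⟩ := hBA s hs
  refine ⟨(r : ℂ) * c, ?_, y, hy, ?_⟩
  · rw [norm_mul, hc, mul_one, Complex.norm_real, Real.norm_eq_abs, abs_of_pos hr.1]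
    exact hr.2.le
  · change r • (s : Cn n) = _
    rw [e, mul_smul]
    rfl

end cone

/-! ### Stone-Weierstrass arguments and conclusion -/

section final
variable {n : ℕ}

lemma res_mul (P Q : Pol n) : res (P * Q) = res P * res Q := by ext s; simp

lemma typ_mul {k l : ℤ} {P Q : Pol n} (hP : P ∈ typ n k) (hQ : Q ∈ typ n l) :
    P * Q ∈ typ n (k + l) := by
  have h : typ n k * typ n l ≤ typ n (k + l) := by
    simp only [typ, Submodule.iSup_mul, Submodule.mul_iSup]
    refine iSup₂_le fun ab' h2 => iSup₂_le fun ab h1 => ?_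
    rw [Submodule.mul_le]
    intro P hP Q hQ
    have h12 : (ab.1 + ab'.1, ab.2 + ab'.2) ∈ {ab : ℕ × ℕ | (ab.1 : ℤ) - ab.2 = k + l} := by
      simp only [Set.mem_ofPred_eq] at h1 h2 ⊢
      push_cast; linarith
    exact (le_iSup₂ (f := fun (ab : ℕ × ℕ) (_ : ab ∈ {ab : ℕ × ℕ | (ab.1 : ℤ) - ab.2 = k + l}) =>
      biHom n ab.1 ab.2) _ h12) (biHom_mul hP hQ)
  exact h (Submodule.mul_mem_mul hP hQ)

lemma biHom_le_typ {a b : ℕ} {k : ℤ} (h : (a : ℤ) - b = k) : biHom n a b ≤ typ n k :=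
  le_iSup₂ (f := fun (ab : ℕ × ℕ) (_ : ab ∈ {ab : ℕ × ℕ | (ab.1 : ℤ) - ab.2 = k}) =>
      biHom n ab.1 ab.2) (a, b) h

lemma XX_mem (i j : Fin n) : (MvPolynomial.X (Sum.inl i) * MvPolynomial.X (Sum.inr j) : Pol n) ∈
    typ n 0 := by
  refine biHom_le_typ (a := 1) (b := 1) (by simp) ⟨?_, ?_⟩
  · exact (MvPolynomial.isWeightedHomogeneous_X ℂ wtl (Sum.inl i)).mul
      (MvPolynomial.isWeightedHomogeneous_X ℂ wtl (Sum.inr j))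
  · exact (MvPolynomial.isWeightedHomogeneous_X ℂ wtr (Sum.inl i)).mul
      (MvPolynomial.isWeightedHomogeneous_X ℂ wtr (Sum.inr j))

lemma C_mem (c : ℂ) : (MvPolynomial.C c : Pol n) ∈ typ n 0 :=
  biHom_le_typ (a := 0) (b := 0) (by simp)
    ⟨MvPolynomial.isWeightedHomogeneous_C _ _, MvPolynomial.isWeightedHomogeneous_C _ _⟩

/-- the projection map to rank-one projections -/
def Prj (s : Sph n) : Fin n × Fin n → ℂ :=
  fun ij => (s : Cn n) ij.1 * (starRingEnd ℂ) ((s : Cn n) ij.2)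

lemma Prj_continuous : Continuous (Prj (n := n)) := by
  unfold Prj
  fun_prop

lemma Prj_eq {s t : Sph n} (h : Prj s = Prj t) : ∃ c : ℂ, ‖c‖ = 1 ∧ (s : Cn n) = c • (t : Cn n) := by
  have hs : ‖(s : Cn n)‖ = 1 := by simp
  have ht : ‖(t : Cn n)‖ = 1 := by simp
  have e : (s : Cn n) = (∑ j, (starRingEnd ℂ) ((t : Cn n) j) * (s : Cn n) j) • (t : Cn n) := by
    ext i
    have h1 : ∑ j, (starRingEnd ℂ) ((s : Cn n) j) * (s : Cn n) j = 1 := by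
      have := EuclideanSpace.norm_sq_eq (s : Cn n)
      rw [hs] at this
      have h2 : ∀ j, (starRingEnd ℂ) ((s : Cn n) j) * (s : Cn n) j =
          ((‖(s : Cn n) j‖ ^ 2 : ℝ) : ℂ) := by
        intro j
        rw [mul_comm, Complex.mul_conj, Complex.normSq_eq_norm_sq]
      simp_rw [h2]
      rw [← Complex.ofReal_sum, ← this]
      simp
    have h3 : ∀ j, (s : Cn n) i * (starRingEnd ℂ) ((s : Cn n) j) =
        (t : Cn n) i * (starRingEnd ℂ) ((t : Cn n) j) := fun j => congrFun h (i, j)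
    calc (s : Cn n) i = (s : Cn n) i * ∑ j, (starRingEnd ℂ) ((s : Cn n) j) * (s : Cn n) j := by
          rw [h1, mul_one]
      _ = ∑ j, ((s : Cn n) i * (starRingEnd ℂ) ((s : Cn n) j)) * (s : Cn n) j := by
          rw [Finset.mul_sum]
          exact Finset.sum_congr rfl fun j _ => by ring
      _ = ∑ j, ((t : Cn n) i * (starRingEnd ℂ) ((t : Cn n) j)) * (s : Cn n) j := by
          simp_rw [h3]
      _ = _ := by
          rw [PiLp.smul_apply, smul_eq_mul, Finset.sum_mul]
          exact Finset.sum_congr rfl fun j _ => by ring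
  refine ⟨_, ?_, e⟩
  have := congrArg norm e
  rw [norm_smul, hs, ht, mul_one] at this
  exact this.symm

abbrev PX (n : ℕ) := Set.range (Prj (n := n))

instance : CompactSpace (PX n) := isCompact_iff_compactSpace.1 (isCompact_range Prj_continuous)

def PrjC : C(Sph n, PX n) :=
  ⟨fun s => ⟨Prj s, s, rfl⟩, Prj_continuous.subtype_mk _⟩

def coordX (ij : Fin n × Fin n) : C(PX n, ℂ) := ⟨fun x => x.1 ij, (continuous_apply ij).comp continuous_subtype_val⟩

def AX (n : ℕ) : StarSubalgebra ℂ C(PX n, ℂ) := StarAlgebra.adjoin ℂ (Set.range coordX)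

lemma AX_dense : (AX n).topologicalClosure = ⊤ := by
  apply ContinuousMap.starSubalgebra_topologicalClosure_eq_top_of_separatesPoints
  intro x y hxy
  have : ∃ ij, x.1 ij ≠ y.1 ij := by
    by_contra h
    push Not at h
    exact hxy (Subtype.ext (funext h))
  obtain ⟨ij, h⟩ := this
  exact ⟨coordX ij, ⟨coordX ij, StarAlgebra.subset_adjoin ℂ _ ⟨ij, rfl⟩, rfl⟩, h⟩

lemma AX_poly {φ : C(PX n, ℂ)} (h : φ ∈ AX n) : ∃ P ∈ typ n 0, res P = φ.comp PrjC := by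
  have h' : φ ∈ Algebra.adjoin ℂ (Set.range (coordX (n := n)) ∪ star (Set.range coordX)) := by
    rw [← StarAlgebra.adjoin_toSubalgebra]; exact h
  clear h
  induction h' using Algebra.adjoin_induction with
  | mem x hx =>
    rcases hx with ⟨ij, rfl⟩ | ⟨ij, hij⟩
    · refine ⟨_, XX_mem ij.1 ij.2, ?_⟩
      ext s
      simp [coordX, PrjC, Prj]
    · have : x = star (coordX ij) := by rw [hij, star_star]
      subst this
      refine ⟨_, XX_mem ij.2 ij.1, ?_⟩
      ext s
      simp [coordX, PrjC, Prj, mul_comm]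
  | algebraMap r =>
    refine ⟨_, C_mem r, ?_⟩
    ext s
    simp
  | add x y hx hy ihx ihy =>
    obtain ⟨P, hP, eP⟩ := ihx
    obtain ⟨Q, hQ, eQ⟩ := ihy
    refine ⟨P + Q, Submodule.add_mem _ hP hQ, ?_⟩
    rw [map_add, eP, eQ]
    rfl
  | mul x y hx hy ihx ihy =>
    obtain ⟨P, hP, eP⟩ := ihx
    obtain ⟨Q, hQ, eQ⟩ := ihy
    have hPQ := typ_mul hP hQ
    rw [add_zero] at hPQ
    refine ⟨P * Q, hPQ, ?_⟩
    rw [res_mul, eP, eQ]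
    rfl

lemma bound_comp (Λ : C(Sph n, ℂ) →L[ℂ] ℂ) {k : ℤ} {C : ℝ}
    (hC : ∀ G ∈ typ n k, ‖Λ (res G)‖ ≤ C * ‖toL2 (res G)‖) {G : Pol n} (hG : G ∈ typ n k)
    (φ : C(PX n, ℂ)) :
    ‖Λ (res G * φ.comp PrjC)‖ ≤ C * ‖toL2 (res G * φ.comp PrjC)‖ := by
  have hcont : Continuous fun φ : C(PX n, ℂ) => res G * φ.comp PrjC :=
    continuous_const.mul (ContinuousMap.continuous_precomp PrjC)
  have hcl : IsClosed {φ : C(PX n, ℂ) |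
      ‖Λ (res G * φ.comp PrjC)‖ ≤ C * ‖toL2 (res G * φ.comp PrjC)‖} :=
    isClosed_le (Λ.continuous.comp hcont).norm
      (continuous_const.mul (toL2.continuous.comp hcont).norm)
  have hsub : ((AX n : StarSubalgebra ℂ C(PX n, ℂ)) : Set C(PX n, ℂ)) ⊆ {φ : C(PX n, ℂ) |
      ‖Λ (res G * φ.comp PrjC)‖ ≤ C * ‖toL2 (res G * φ.comp PrjC)‖} := by
    intro φ hφ
    obtain ⟨P, hP, e⟩ := AX_poly hφ
    rw [Set.mem_ofPred_eq, ← e, ← res_mul]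
    refine hC _ ?_
    have := typ_mul hG hP
    rwa [add_zero] at this
  have hmem : φ ∈ (AX n).topologicalClosure := by rw [AX_dense]; trivial
  exact hcl.closure_subset_iff.2 hsub hmem

lemma res_dense : Dense (Set.range (res (n := n))) := by
  set S : Set C(Sph n, ℂ) := Set.range (fun i : Fin n => res (MvPolynomial.X (Sum.inl i)))
  have h1 : (StarAlgebra.adjoin ℂ S).topologicalClosure = ⊤ := by
    apply ContinuousMap.starSubalgebra_topologicalClosure_eq_top_of_separatesPoints
    intro x y hxy
    have : ∃ i, (x : Cn n) i ≠ (y : Cn n) i := by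
      by_contra h
      push Not at h
      exact hxy (Subtype.ext (PiLp.ext h))
    obtain ⟨i, h⟩ := this
    exact ⟨_, ⟨res (MvPolynomial.X (Sum.inl i)), StarAlgebra.subset_adjoin ℂ _ ⟨i, rfl⟩, rfl⟩,
      by simpa using h⟩
  have h2 : ∀ φ ∈ StarAlgebra.adjoin ℂ S, φ ∈ Set.range (res (n := n)) := by
    intro φ hφ
    induction hφ using StarAlgebra.adjoin_induction with
    | mem x hx =>
      obtain ⟨i, rfl⟩ := hx
      exact ⟨_, rfl⟩
    | algebraMap r => exact ⟨MvPolynomial.C r, by ext s; simp⟩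
    | add x y hx hy ihx ihy =>
      obtain ⟨P, rfl⟩ := ihx
      obtain ⟨Q, rfl⟩ := ihy
      exact ⟨P + Q, map_add _ _ _⟩
    | mul x y hx hy ihx ihy =>
      obtain ⟨P, rfl⟩ := ihx
      obtain ⟨Q, rfl⟩ := ihy
      exact ⟨P * Q, res_mul _ _⟩
    | star x hx ihx =>
      obtain ⟨P, rfl⟩ := ihx
      exact ⟨conjP P, by ext s; simp [ev_conjP]⟩
  intro φ
  have hmem : φ ∈ (StarAlgebra.adjoin ℂ S).topologicalClosure := by rw [h1]; trivial
  exact closure_mono h2 hmem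

lemma Lam_zero (Λ : C(Sph n, ℂ) →L[ℂ] ℂ)
    (h : ∀ a b : ℕ, ∀ G ∈ biHom n a b, Λ (res G) = 0) (φ : C(Sph n, ℂ)) : Λ φ = 0 := by
  have h1 : ∀ P : Pol n, Λ (res P) = 0 := by
    intro P
    induction P using MvPolynomial.induction_on' with
    | monomial u a =>
      exact h _ _ _ ⟨MvPolynomial.isWeightedHomogeneous_monomial _ _ _ rfl,
        MvPolynomial.isWeightedHomogeneous_monomial _ _ _ rfl⟩
    | add p q hp hq => rw [map_add, map_add, hp, hq, add_zero]
  have h2 : IsClosed {φ : C(Sph n, ℂ) | Λ φ = 0} := isClosed_eq Λ.continuous continuous_const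
  have h3 : Set.range (res (n := n)) ⊆ {φ : C(Sph n, ℂ) | Λ φ = 0} := by
    rintro _ ⟨P, rfl⟩
    exact h1 P
  exact h2.closure_subset_iff.2 h3 (res_dense φ)

/-- thickened indicator as a complex continuous function -/
def thI {Y : Type*} [PseudoEMetricSpace Y] (D : Set Y) (j : ℕ) : C(Y, ℂ) :=
  ⟨fun y => ((thickenedIndicator (Nat.one_div_pos_of_nat (α := ℝ) (n := j)) D y : ℝ≥0) : ℂ), by
    have : Continuous (thickenedIndicator (Nat.one_div_pos_of_nat (α := ℝ) (n := j)) D) :=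
      map_continuous _
    exact Complex.continuous_ofReal.comp (NNReal.continuous_coe.comp this)⟩

lemma thI_norm {Y : Type*} [PseudoEMetricSpace Y] (D : Set Y) (j : ℕ) (y : Y) :
    ‖thI D j y‖ ≤ 1 := by
  have := thickenedIndicator_le_one (Nat.one_div_pos_of_nat (α := ℝ) (n := j)) D y
  change ‖(((thickenedIndicator (Nat.one_div_pos_of_nat (α := ℝ) (n := j)) D y : ℝ≥0) : ℝ) : ℂ)‖ ≤ 1
  rw [Complex.norm_real, Real.norm_eq_abs, NNReal.abs_eq]
  exact_mod_cast this

lemma thI_lim {Y : Type*} [PseudoEMetricSpace Y] {D : Set Y} (hD : IsClosed D) (y : Y) :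
    Filter.Tendsto (fun j => thI D j y) Filter.atTop (nhds (D.indicator (fun _ => (1 : ℂ)) y)) := by
  have h := thickenedIndicator_tendsto_indicator_closure
    (fun j : ℕ => Nat.one_div_pos_of_nat (α := ℝ) (n := j)) tendsto_one_div_add_atTop_nhds_zero_nat D
  rw [hD.closure_eq, tendsto_pi_nhds] at h
  have h1 := h y
  have h2 : D.indicator (fun _ => (1 : ℂ)) y =
      (((D.indicator (fun _ => (1 : ℝ≥0)) y : ℝ≥0) : ℝ) : ℂ) := by
    by_cases hy : y ∈ D <;> simp [hy]
  rw [h2]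
  exact ((Complex.continuous_ofReal.comp NNReal.continuous_coe).tendsto _).comp h1

lemma thI_int {Y : Type*} [PseudoEMetricSpace Y] {D : Set Y} (hD : IsClosed D)
    {p : Sph n → Y} (hp : Continuous p) (ρ : Measure (Sph n)) (h : Sph n → ℂ)
    (hh : Integrable h ρ) :
    Filter.Tendsto (fun j => ∫ s, thI D j (p s) * h s ∂ρ) Filter.atTop
      (nhds (∫ s in p ⁻¹' D, h s ∂ρ)) := by
  rw [← integral_indicator (hD.preimage hp).measurableSet]
  refine tendsto_integral_of_dominated_convergence (fun s => ‖h s‖) ?_ hh.norm ?_ ?_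
  · intro j
    exact ((map_continuous (thI D j)).comp hp).aestronglyMeasurable.mul hh.1
  · intro j
    refine ae_of_all _ fun s => ?_
    rw [norm_mul]
    exact mul_le_of_le_one_left (norm_nonneg _) (thI_norm D j _)
  · refine ae_of_all _ fun s => ?_
    have := (thI_lim hD (p s)).mul_const (h s)
    convert this using 2
    by_cases hs : p s ∈ D
    · simp [hs]
    · simp [hs]

lemma toL2_lim (G : Pol n) {D : Set (Fin n × Fin n → ℂ)} (hD : IsClosed D)
    (hnull : sig n (Prj ⁻¹' D) = 0) (ψ : ℕ → C(Sph n, ℂ))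
    (hψ : ∀ j s, ψ j s = res G s * thI D j (Prj s)) :
    Filter.Tendsto (fun j => ‖toL2 (ψ j)‖) Filter.atTop (nhds 0) := by
  have h1 : Filter.Tendsto (fun j => inner ℂ (toL2 (ψ j)) (toL2 (ψ j))) Filter.atTop
      (nhds (0 : ℂ)) := by
    simp_rw [inner_toL2]
    have h0 : (∫ _ : Sph n, (0 : ℂ) ∂sig n) = 0 := by simp
    rw [← h0]
    refine tendsto_integral_of_dominated_convergence (fun _ => ‖res G‖ * ‖res G‖) ?_
      (integrable_const _) ?_ ?_
    · intro j
      exact ((map_continuous (ψ j)).mul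
        (Complex.continuous_conj.comp (map_continuous (ψ j)))).aestronglyMeasurable
    · intro j
      refine ae_of_all _ fun s => ?_
      have : ‖ψ j s‖ ≤ ‖res G‖ := by
        rw [hψ, norm_mul]
        exact (mul_le_of_le_one_right (norm_nonneg _) (thI_norm D j _)).trans
          ((res G).norm_coe_le_norm s)
      rw [norm_mul, RCLike.norm_conj]
      gcongr
    · have hae : ∀ᵐ s ∂sig n, s ∉ Prj ⁻¹' D := measure_eq_zero_iff_ae_notMem.1 hnull
      filter_upwards [hae] with s hs
      have hs' : Prj s ∉ D := hs
      have h2 := (thI_lim hD (Prj s)).const_mul (res G s)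
      rw [Set.indicator_of_notMem hs', mul_zero] at h2
      have h3 := h2.mul ((Complex.continuous_conj.tendsto _).comp h2)
      rw [zero_mul] at h3
      refine h3.congr fun j => ?_
      simp only [hψ, Function.comp]
  have h2 : Filter.Tendsto (fun j => ‖toL2 (ψ j)‖ ^ 2) Filter.atTop (nhds 0) := by
    have := h1.norm
    rw [norm_zero] at this
    refine this.congr fun j => ?_
    rw [inner_self_eq_norm_sq_to_K]
    simp
  have h3 := h2.sqrt
  rw [Real.sqrt_zero] at h3
  exact h3.congr fun j => Real.sqrt_sq (norm_nonneg _)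

lemma orbit_zero (hn : 2 ≤ n) (ε : ℝ) (hε0 : 0 < ε) (hε1 : ε < 1) (F : Finset (ℕ × ℕ))
    (ρ : Measure (Sph n)) [IsFiniteMeasure ρ] (g : Sph n → ℂ) (hg : Integrable g ρ)
    (hspec : ∀ p q : ℕ, (p, q) ∉ F → memKappa ε p q → ∀ H ∈ harm n p q,
      Lam ρ g hg (res H) = 0)
    {D : Set (Fin n × Fin n → ℂ)} (hD : IsClosed D) (hnull : sig n (Prj ⁻¹' D) = 0)
    {a b : ℕ} {G : Pol n} (hG : G ∈ biHom n a b) :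
    ∫ s in Prj ⁻¹' D, res G s * g s ∂ρ = 0 := by
  obtain ⟨C, hC⟩ := key_bound hn ε hε0 hε1 F (Lam ρ g hg) hspec ((a : ℤ) - b)
  let φ : ℕ → C(PX n, ℂ) := fun j => (thI D j).comp ⟨Subtype.val, continuous_subtype_val⟩
  have hb := fun j => bound_comp (Lam ρ g hg) hC (biHom_le_typ rfl hG) (φ j)
  have hψ : ∀ j s, (res G * (φ j).comp PrjC) s = res G s * thI D j (Prj s) := fun j s => rfl
  have hl := (toL2_lim G hD hnull _ hψ).const_mul C
  rw [mul_zero] at hl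
  have h0 : Filter.Tendsto (fun j => Lam ρ g hg (res G * (φ j).comp PrjC)) Filter.atTop
      (nhds 0) := squeeze_zero_norm hb hl
  have hGint : Integrable (fun s => res G s * g s) ρ :=
    hg.bdd_mul (c := ‖res G‖) (map_continuous (res G)).aestronglyMeasurable
      (ae_of_all _ fun s => (res G).norm_coe_le_norm s)
  refine tendsto_nhds_unique ((thI_int hD Prj_continuous ρ _ hGint).congr fun j => ?_) h0
  rw [Lam_apply]
  refine integral_congr_ae (ae_of_all _ fun s => ?_)
  simp only [hψ]
  ring

lemma compact_zero (hn : 2 ≤ n) (ε : ℝ) (hε0 : 0 < ε) (hε1 : ε < 1) (F : Finset (ℕ × ℕ))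
    (ρ : Measure (Sph n)) [IsFiniteMeasure ρ] (g : Sph n → ℂ) (hg : Integrable g ρ)
    (hspec : ∀ p q : ℕ, (p, q) ∉ F → memKappa ε p q → ∀ H ∈ harm n p q,
      Lam ρ g hg (res H) = 0)
    {K : Set (Sph n)} (hK : IsClosed K)
    (hdim : dimH ((Subtype.val '' K : Set (Cn n))) < (2 * n - 2 : ℕ)) :
    ∫ s in K, g s ∂ρ = 0 := by
  set D := Prj '' K with hDdef
  have hD : IsClosed D := (hK.isCompact.image Prj_continuous).isClosed
  have hcone := cone_null hn (Subtype.val '' K : Set (Cn n)) (by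
    rintro _ ⟨s, _, rfl⟩
    simp) hdim
  have hB : MeasurableSet (Prj ⁻¹' D) := (hD.preimage Prj_continuous).measurableSet
  have hnull : sig n (Prj ⁻¹' D) = 0 := by
    refine sig_null hcone _ hB ?_
    rintro s ⟨t, ht, e⟩
    obtain ⟨c, hc, e⟩ := Prj_eq e.symm
    exact ⟨c, hc, t, ⟨t, ht, rfl⟩, e⟩
  have hg' : Integrable g (ρ.restrict (Prj ⁻¹' D)) := hg.restrict
  have hz := Lam_zero (Lam (ρ.restrict (Prj ⁻¹' D)) g hg') (fun a b G hG =>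
    orbit_zero hn ε hε0 hε1 F ρ g hg hspec hD hnull hG)
  have hlim := thI_int hK continuous_id (ρ.restrict (Prj ⁻¹' D)) g hg'
  have hlim0 : Filter.Tendsto (fun j => ∫ s, thI K j (id s) * g s ∂(ρ.restrict (Prj ⁻¹' D)))
      Filter.atTop (nhds 0) :=
    tendsto_const_nhds.congr fun j => (hz (thI K j)).symm
  have := tendsto_nhds_unique hlim hlim0
  rw [Measure.restrict_restrict (hK.preimage continuous_id).measurableSet, Set.preimage_id,
    Set.inter_eq_left.2 (Set.subset_preimage_image Prj K)] at this
  exact this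

lemma integral_zero_of_compact (ν : Measure (Cn n)) [IsFiniteMeasure ν] (f : Cn n → ℂ)
    (hf : Integrable f ν) (E : Set (Cn n)) (hE : MeasurableSet E)
    (h : ∀ K ⊆ E, IsCompact K → ∫ x in K, f x ∂ν = 0) : ∫ x in E, f x ∂ν = 0 := by
  have hfin : IsFiniteMeasure (ν.withDensity fun x => ‖f x‖ₑ) :=
    isFiniteMeasure_withDensity hf.2.ne
  rw [← norm_eq_zero]
  refine le_antisymm (le_of_forall_pos_le_add fun δ hδ => ?_) (norm_nonneg _)
  rw [zero_add]
  obtain ⟨K, hKE, hK, hlt⟩ := hE.exists_isCompact_sdiff_lt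
    (μ := ν.withDensity fun x => ‖f x‖ₑ) (measure_ne_top _ _)
    (ε := ENNReal.ofReal δ) (by simpa using hδ)
  have hEK : MeasurableSet (E \ K) := hE.diff hK.measurableSet
  rw [withDensity_apply _ hEK] at hlt
  have h1 : ∫ x in E, f x ∂ν = ∫ x in E \ K, f x ∂ν := by
    rw [integral_diff hK.measurableSet hf.integrableOn hKE, h K hKE hK, sub_zero]
  rw [h1]
  have h2 := enorm_integral_le_lintegral_enorm (μ := ν.restrict (E \ K)) f
  have h3 := h2.trans hlt.le
  rw [← ofReal_norm_eq_enorm] at h3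
  exact (ENNReal.ofReal_le_ofReal_iff hδ.le).1 h3

end final

/-- a finite complex measure `μ = f·ν` on `S^{2n−1}` whose spectrum meets
`κ(ε)` in a finite set satisfies `μ(E) = 0` for every Borel `E` with
`dim_H E < 2n−2`. -/
theorem stmt10 {n : ℕ} (hn : 2 ≤ n)
    (ν : Measure (EuclideanSpace ℂ (Fin n))) [IsFiniteMeasure ν]
    (hsupp : ν (unitSphere n)ᶜ = 0)
    (f : EuclideanSpace ℂ (Fin n) → ℂ) (hf : Integrable f ν)
    (ε : ℝ) (hε0 : 0 < ε) (hε1 : ε < 1) (F : Finset (ℕ × ℕ))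
    (hspec : ∀ p q : ℕ, (p, q) ∉ F → memKappa ε p q → projPQZero ν f p q)
    (E : Set (EuclideanSpace ℂ (Fin n))) (hEs : E ⊆ unitSphere n)
    (hE : MeasurableSet E) (hdim : dimH E < (2 * n - 2 : ℕ)) :
    ∫ x in E, f x ∂ν = 0 := by
  refine integral_zero_of_compact ν f hf E hE ?_
  intro K hKE hK
  have hSm : MeasurableSet (Metric.sphere (0 : Cn n) 1) := isClosed_sphere.measurableSet
  have hemb : MeasurableEmbedding (Subtype.val : Sph n → Cn n) :=
    MeasurableEmbedding.subtype_coe hSm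
  set ρ : Measure (Sph n) := ν.comap Subtype.val with hρ
  have hmap : ρ.map Subtype.val = ν := by
    rw [hρ, map_comap_subtype_coe hSm]
    refine Measure.restrict_eq_self_of_ae_mem ?_
    rw [ae_iff]
    exact hsupp
  have hρfin : IsFiniteMeasure ρ := by
    constructor
    have : ρ Set.univ = ν Set.univ := by
      conv_rhs => rw [← hmap]
      rw [hemb.map_apply, Set.preimage_univ]
    rw [this]
    exact measure_lt_top _ _
  have hf' : Integrable (fun s : Sph n => f s) ρ := by
    have := hf
    rw [← hmap, hemb.integrable_map_iff] at this
    exact this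
  have hg : Integrable (fun s : Sph n => (starRingEnd ℂ) (f s)) ρ :=
    hf'.mono (Complex.continuous_conj.comp_aestronglyMeasurable hf'.1)
      (ae_of_all _ fun s => by simp)
  have hz := compact_zero hn ε hε0 hε1 F ρ _ hg (fun p q hF hk H hH => by
    have h1 := hspec p q hF hk (ev H) (memHpq_ev hH)
    rw [← hmap, hemb.integral_map] at h1
    rw [Lam_apply]
    have h2 := congrArg (starRingEnd ℂ) h1
    rw [← integral_conj, map_zero] at h2
    rw [← h2]
    refine integral_congr_ae (ae_of_all _ fun s => ?_)
    simp) (K := Subtype.val ⁻¹' K) (hK.isClosed.preimage continuous_subtype_val)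
    (lt_of_le_of_lt (dimH_mono ((Set.image_preimage_subset _ _).trans hKE)) hdim)
  rw [integral_conj, map_eq_zero] at hz
  rw [← hmap, hemb.setIntegral_map]
  exact hz
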